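/- arXiv:2509.01148 — 9 statements merged into one kernel-verified Lean document; each statement's English description precedes it below -/
import Mathlib

section
/- Let n, m ≥ 1 and let g : ℝ^n × ℝ^m → ℝ be infinitely differentiable. For a ∈ ℝ^m define the perturbed function g̃_a(x,y) = g(x,y) + ⟨a, y⟩. Then for every ν > 0, for Lebesgue-almost every a in the cube [−ν, ν]^m, the bifurcation set of g̃_a, namely the set {x ∈ ℝ^n : there exists y ∈ ℝ^m with ∇_y g(x,y) + a = 0 and det ∇²_{yy} g(x,y) = 0}, is a Lebesgue-null subset of ℝ^n; equivalently, for almost every a, the function y ↦ g(x,y) + ⟨a,y⟩ is Morse in y for almost every x. -/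
open MeasureTheory

/-- The Hessian of `f` at `y`, as a linear endomorphism (the derivative of the gradient map). -/
noncomputable def hessLM {m : ℕ} (f : EuclideanSpace ℝ (Fin m) → ℝ)
    (y : EuclideanSpace ℝ (Fin m)) :
    EuclideanSpace ℝ (Fin m) →ₗ[ℝ] EuclideanSpace ℝ (Fin m) :=
  (fderiv ℝ (fun y' => gradient f y') y).toLinearMap

/-- A σ-compact subset of a Hausdorff Borel space is measurable. -/
theorem IsSigmaCompact.measurableSet_of_t2 {X : Type*} [TopologicalSpace X] [T2Space X]
    [MeasurableSpace X] [BorelSpace X] {s : Set X} (hs : IsSigmaCompact s) :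
    MeasurableSet s := by
  obtain ⟨K, hK, rfl⟩ := hs
  exact MeasurableSet.iUnion fun i => (hK i).measurableSet

/-- The partial gradient of a smooth function depends smoothly on all variables. -/
theorem ContDiff.gradient_right {E F : Type*} [NormedAddCommGroup E] [NormedSpace ℝ E]
    [NormedAddCommGroup F] [InnerProductSpace ℝ F] [CompleteSpace F] {g : E × F → ℝ}
    (hg : ContDiff ℝ (⊤ : ℕ∞) g) :
    ContDiff ℝ (⊤ : ℕ∞) fun p : E × F => gradient (fun y => g (p.1, y)) p.2 := by
  have h : ContDiff ℝ (⊤ : ℕ∞) fun p : E × F => fderiv ℝ (fun y => g (p.1, y)) p.2 := by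
    refine ContDiff.fderiv (f := fun (p : E × F) y => g (p.1, y)) (m := (⊤ : ℕ∞))
      (n := (⊤ : ℕ∞)) ?_ contDiff_snd (by simp)
    exact hg.comp ((contDiff_fst.comp contDiff_fst).prodMk contDiff_snd)
  exact (InnerProductSpace.toDual ℝ F).symm.toContinuousLinearEquiv.contDiff.comp h

/-- The determinant of the partial Hessian of a smooth function is continuous. -/
theorem continuous_det_hessLM {E : Type*} [NormedAddCommGroup E] [NormedSpace ℝ E] {m : ℕ}
    {g : E × EuclideanSpace ℝ (Fin m) → ℝ} (hg : ContDiff ℝ (⊤ : ℕ∞) g) :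
    Continuous fun p : E × EuclideanSpace ℝ (Fin m) =>
      LinearMap.det (hessLM (fun y => g (p.1, y)) p.2) := by
  have h : ContDiff ℝ (⊤ : ℕ∞) fun p : E × EuclideanSpace ℝ (Fin m) =>
      fderiv ℝ (fun z => gradient (fun y => g (p.1, y)) z) p.2 := by
    refine ContDiff.fderiv
      (f := fun (p : E × EuclideanSpace ℝ (Fin m)) z => gradient (fun y => g (p.1, y)) z)
      (m := (⊤ : ℕ∞)) (n := (⊤ : ℕ∞)) ?_ contDiff_snd (by simp)
    exact hg.gradient_right.comp ((contDiff_fst.comp contDiff_fst).prodMk contDiff_snd)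
  exact ContinuousLinearMap.continuous_det.comp h.continuous

/-- For a smooth `g : ℝⁿ × ℝᵐ → ℝ` and any ν > 0, for Lebesgue-almost
every `a` in the cube `[-ν, ν]^m`, the bifurcation set of the linearly perturbed function
`(x,y) ↦ g(x,y) + ⟨a,y⟩`, i.e. the set of `x` for which `y ↦ g(x,y) + ⟨a,y⟩` has a
degenerate stationary point, is Lebesgue-null. -/
theorem stmt_0 (n m : ℕ) (hn : 1 ≤ n) (hm : 1 ≤ m)
    (g : EuclideanSpace ℝ (Fin n) × EuclideanSpace ℝ (Fin m) → ℝ)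
    (hg : ContDiff ℝ (⊤ : ℕ∞) g) (ν : ℝ) (hν : 0 < ν) :
    ∀ᵐ a ∂((volume : Measure (EuclideanSpace ℝ (Fin m))).restrict
        {a | ∀ i, a i ∈ Set.Icc (-ν) ν}),
      volume {x : EuclideanSpace ℝ (Fin n) |
        ∃ y : EuclideanSpace ℝ (Fin m),
          gradient (fun y' => g (x, y')) y + a = 0 ∧
          LinearMap.det (hessLM (fun y' => g (x, y')) y) = 0} = 0 := by
  refine ae_restrict_of_ae ?_
  let D (x : EuclideanSpace ℝ (Fin n)) (a : EuclideanSpace ℝ (Fin m)) : Prop :=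
    ∃ y : EuclideanSpace ℝ (Fin m), gradient (fun y' => g (x, y')) y + a = 0 ∧
      LinearMap.det (hessLM (fun y' => g (x, y')) y) = 0
  have hD : MeasurableSet {p : EuclideanSpace ℝ (Fin n) × EuclideanSpace ℝ (Fin m) |
      D p.1 p.2} := by
    have himage : {p : EuclideanSpace ℝ (Fin n) × EuclideanSpace ℝ (Fin m) | D p.1 p.2} =
        (fun p : EuclideanSpace ℝ (Fin n) × EuclideanSpace ℝ (Fin m) =>
          (p.1, -gradient (fun y' => g (p.1, y')) p.2)) ''
          {p | LinearMap.det (hessLM (fun y' => g (p.1, y')) p.2) = 0} := by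
      ext ⟨x, a⟩
      constructor
      · rintro ⟨y, hy, hdet⟩
        exact ⟨(x, y), hdet, Prod.ext rfl (neg_eq_of_add_eq_zero_right hy)⟩
      · rintro ⟨⟨x', y⟩, hdet, hxy⟩
        obtain ⟨rfl, rfl⟩ := Prod.mk.inj hxy
        exact ⟨y, add_neg_cancel _, hdet⟩
    rw [himage]
    refine IsSigmaCompact.measurableSet_of_t2 (IsSigmaCompact.image ?_ ?_)
    · exact continuous_fst.prodMk hg.gradient_right.continuous.neg
    · exact isSigmaCompact_univ.of_isClosed_subset
        (isClosed_eq (continuous_det_hessLM hg) continuous_const) (Set.subset_univ _)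
  have hslice (x : EuclideanSpace ℝ (Fin n)) : ∀ᵐ a, ¬ D x a := by
    have hgrad : Differentiable ℝ fun y => gradient (fun y' => g (x, y')) y :=
      (hg.gradient_right.comp (contDiff_prodMk_right x)).differentiable (by simp)
    have hnull := addHaar_image_eq_zero_of_det_fderivWithin_eq_zero volume
      (s := {y | LinearMap.det (hessLM (fun y' => g (x, y')) y) = 0})
      (fun y _ => (hgrad y).hasFDerivAt.neg.hasFDerivWithinAt) ?_
    · refine measure_mono_null ?_ hnull
      intro a ha
      obtain ⟨y, hy, hdet⟩ := not_not.mp ha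
      exact ⟨y, hdet, neg_eq_of_add_eq_zero_right hy⟩
    · intro y hy
      change LinearMap.det (-(hessLM (fun y' => g (x, y')) y)) = 0
      rw [← neg_one_smul ℝ, LinearMap.det_smul, hy, mul_zero]
  have hae := (Measure.ae_ae_comm (μ := volume) (ν := volume) hD.compl).mp
    (Filter.Eventually.of_forall hslice)
  filter_upwards [hae] with a ha
  simpa [ae_iff, D] using ha
end

section
/- Let m ≥ 1 and let g : ℝ^m → ℝ be twice continuously differentiable. Then for Lebesgue-almost every a ∈ ℝ^m, the function y ↦ g(y) + ⟨a, y⟩ is Morse; that is, the set {a ∈ ℝ^m : there exists y ∈ ℝ^m with ∇g(y) + a = 0 and det ∇²g(y) = 0} is a Lebesgue-null subset of ℝ^m. (Equivalently, the set of critical values of the gradient map y ↦ ∇g(y), i.e. the values attained at points where the Hessian ∇²g(y) is singular, has Lebesgue measure zero.) -/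
open MeasureTheory

/-- The gradient of a C² function on a Hilbert space is differentiable. -/
theorem ContDiff.differentiable_gradient {F : Type*} [NormedAddCommGroup F]
    [InnerProductSpace ℝ F] [CompleteSpace F] {f : F → ℝ} (hf : ContDiff ℝ 2 f) :
    Differentiable ℝ (gradient f) :=
  (InnerProductSpace.toDual ℝ F).symm.toContinuousLinearEquiv.differentiable.comp
    ((hf.fderiv_right (m := 1) le_rfl).differentiable one_ne_zero)

/-- For a C² function `g : ℝᵐ → ℝ`, for Lebesgue-almost every `a ∈ ℝᵐ`
the function `y ↦ g(y) + ⟨a,y⟩` is Morse: the set of `a` for which there is a point `y`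
with `∇g(y) + a = 0` and singular Hessian `∇²g(y)` is Lebesgue-null. -/
theorem stmt_1 (m : ℕ) (hm : 1 ≤ m)
    (g : EuclideanSpace ℝ (Fin m) → ℝ) (hg : ContDiff ℝ 2 g) :
    volume {a : EuclideanSpace ℝ (Fin m) |
      ∃ y : EuclideanSpace ℝ (Fin m),
        gradient g y + a = 0 ∧ LinearMap.det (hessLM g y) = 0} = 0 := by
  have h_null : volume (gradient g '' {y | LinearMap.det (hessLM g y) = 0}) = 0 :=
    addHaar_image_eq_zero_of_det_fderivWithin_eq_zero volume
      (fun y _ => (hg.differentiable_gradient y).hasFDerivAt.hasFDerivWithinAt) fun _ hy => hy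
  rw [← Measure.measure_preimage_neg] at h_null
  refine measure_mono_null ?_ h_null
  rintro a ⟨y, hy, hdet⟩
  exact ⟨y, hdet, eq_neg_of_add_eq_zero_left hy⟩
end

section
/- Let φ : ℝ^n → ℝ be bounded and Lebesgue-measurable, and suppose φ is (Fréchet) differentiable at a point x̄ ∈ ℝ^n with gradient ∇φ(x̄). Then ∇φ_ξ(x̄) → ∇φ(x̄) as ξ → 0⁺. Consequently, for every nonempty closed convex set X ⊆ ℝ^n and every β > 0, the projected gradient mappings converge: P_X(x̄, ∇φ_ξ(x̄), β) → P_X(x̄, ∇φ(x̄), β) as ξ → 0⁺. -/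
open MeasureTheory

/-- The Gaussian kernel `h_ξ(z) = (2πξ²)^{-n/2} exp(-‖z‖²/(2ξ²))` on `ℝⁿ`. -/
noncomputable def gaussKernel (n : ℕ) (ξ : ℝ) (z : EuclideanSpace ℝ (Fin n)) : ℝ :=
  (2 * Real.pi * ξ ^ 2) ^ (-(n : ℝ) / 2) * Real.exp (-‖z‖ ^ 2 / (2 * ξ ^ 2))

/-- The Gaussian smoothing `φ_ξ(x) = ∫ h_ξ(x - z) φ(z) dz`. -/
noncomputable def gaussSmooth (n : ℕ) (ξ : ℝ) (φ : EuclideanSpace ℝ (Fin n) → ℝ)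
    (x : EuclideanSpace ℝ (Fin n)) : ℝ :=
  ∫ z, gaussKernel n ξ (x - z) * φ z

open scoped InnerProductSpace

theorem hasFDerivAt_rexp_neg_half_sq_norm {V : Type*} [NormedAddCommGroup V]
    [InnerProductSpace ℝ V] (v : V) :
    HasFDerivAt (fun v : V ↦ Real.exp (-(1 / 2) * ‖v‖ ^ 2))
      (-Real.exp (-(1 / 2) * ‖v‖ ^ 2) • innerSL ℝ v) v := by
  convert! (((hasStrictFDerivAt_norm_sq v).hasFDerivAt.const_mul (-(1 / 2))).exp) using 1
  ext w
  simp

section GaussianMoments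

variable {V : Type*} [NormedAddCommGroup V] [InnerProductSpace ℝ V] [FiniteDimensional ℝ V]
  [MeasurableSpace V] [BorelSpace V]

theorem integrable_rexp_neg_mul_sq_norm {b : ℝ} (hb : 0 < b) :
    Integrable (fun v : V ↦ Real.exp (-b * ‖v‖ ^ 2)) := by
  have h := (GaussianFourier.integrable_cexp_neg_mul_sq_norm_add (b := (b : ℂ)) (by simpa using hb)
    0 (0 : V)).norm
  refine h.congr (.of_forall fun v ↦ ?_)
  simp [Complex.norm_exp, ← Complex.ofReal_pow]

theorem integrable_one_add_sq_norm_mul_rexp {b : ℝ} (hb : 0 < b) :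
    Integrable (fun v : V ↦ (1 + ‖v‖ ^ 2) * Real.exp (-b * ‖v‖ ^ 2)) := by
  refine ((integrable_rexp_neg_mul_sq_norm (V := V) (half_pos hb)).const_mul (1 + 2 / b)).mono'
    (by fun_prop) (.of_forall fun v ↦ ?_)
  rw [Real.norm_of_nonneg (by positivity)]
  have h1 : 1 + ‖v‖ ^ 2 ≤ (1 + 2 / b) * Real.exp (b / 2 * ‖v‖ ^ 2) := calc
    1 + ‖v‖ ^ 2 ≤ (1 + 2 / b) * (b / 2 * ‖v‖ ^ 2 + 1) := by
      have : (1 + 2 / b) * (b / 2 * ‖v‖ ^ 2 + 1)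
        = 1 + ‖v‖ ^ 2 + (b / 2 * ‖v‖ ^ 2 + 2 / b) := by field
      rw [this]
      exact le_add_of_nonneg_right (by positivity)
    _ ≤ _ := by gcongr; exact Real.add_one_le_exp _
  calc (1 + ‖v‖ ^ 2) * Real.exp (-b * ‖v‖ ^ 2)
      ≤ (1 + 2 / b) * Real.exp (b / 2 * ‖v‖ ^ 2) * Real.exp (-b * ‖v‖ ^ 2) := by gcongr
    _ = _ := by rw [mul_assoc, ← Real.exp_add]; ring_nf

theorem integral_rexp_neg_half_sq_norm_smul_id :
    ∫ v : V, Real.exp (-(1 / 2) * ‖v‖ ^ 2) • v = 0 := by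
  have h := integral_neg_eq_self (fun v : V ↦ Real.exp (-(1 / 2) * ‖v‖ ^ 2) • v) volume
  simp only [norm_neg, smul_neg, integral_neg] at h
  have := IsAddTorsionFree.of_isTorsionFree ℝ V
  exact self_eq_neg.mp h.symm

theorem integrable_rexp_neg_half_sq_norm_mul_inner_smul_id (G : V) :
    Integrable (fun v : V ↦ (Real.exp (-(1 / 2) * ‖v‖ ^ 2) * ⟪G, v⟫_ℝ) • v) := by
  refine ((integrable_one_add_sq_norm_mul_rexp (V := V) one_half_pos).const_mul ‖G‖).mono'
    (by fun_prop) (.of_forall fun v ↦ ?_)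
  rw [norm_smul, norm_mul, Real.norm_of_nonneg (Real.exp_pos _).le]
  calc _ ≤ Real.exp (-(1 / 2) * ‖v‖ ^ 2) * (‖G‖ * ‖v‖) * ‖v‖ := by
        gcongr; exact norm_inner_le_norm _ _
    _ = ‖G‖ * (‖v‖ ^ 2 * Real.exp (-(1 / 2) * ‖v‖ ^ 2)) := by ring
    _ ≤ _ := by gcongr; linarith

theorem integral_rexp_neg_half_sq_norm_mul_inner_smul_id (G : V) :
    ∫ v : V, (Real.exp (-(1 / 2) * ‖v‖ ^ 2) * ⟪G, v⟫_ℝ) • v =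
      (∫ v : V, Real.exp (-(1 / 2) * ‖v‖ ^ 2)) • G := by
  refine ext_inner_left ℝ fun w ↦ ?_
  have hint := integrable_rexp_neg_half_sq_norm_mul_inner_smul_id G
  rw [← integral_inner hint, inner_smul_right]
  have hI : Integrable (fun v : V ↦ Real.exp (-(1 / 2) * ‖v‖ ^ 2)) :=
    integrable_rexp_neg_mul_sq_norm one_half_pos
  have h := integral_bilinear_hasFDerivAt_right_eq_neg_left_of_integrable
    (μ := (volume : Measure V)) (f := fun v : V ↦ ⟪G, v⟫_ℝ) (f' := fun _ ↦ innerSL ℝ G)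
    (g := fun v : V ↦ Real.exp (-(1 / 2) * ‖v‖ ^ 2))
    (g' := fun v ↦ -Real.exp (-(1 / 2) * ‖v‖ ^ 2) • innerSL ℝ v)
    (v := w) (B := ContinuousLinearMap.mul ℝ ℝ) ?_ ?_ ?_
    (fun v _ ↦ (innerSL ℝ G).hasFDerivAt) (fun v _ ↦ hasFDerivAt_rexp_neg_half_sq_norm v)
  · simp only [ContinuousLinearMap.mul_apply', innerSL_apply_apply, smul_apply,
      smul_eq_mul, integral_const_mul] at h
    rw [real_inner_comm, mul_comm, ← neg_inj, ← h, ← integral_neg]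
    congr 1 with v
    rw [inner_smul_right, real_inner_comm v w]
    ring
  · simpa using hI.const_mul ⟪G, w⟫_ℝ
  · refine (hint.const_inner w).neg.congr (.of_forall fun v ↦ ?_)
    simp [inner_smul_right, real_inner_comm v w]
    ring
  · refine ((integrable_one_add_sq_norm_mul_rexp (V := V) one_half_pos).const_mul ‖G‖).mono'
      (by fun_prop) (.of_forall fun v ↦ ?_)
    simp only [ContinuousLinearMap.mul_apply', norm_mul, Real.norm_of_nonneg (Real.exp_pos _).le]
    calc _ ≤ ‖G‖ * ‖v‖ * Real.exp (-(1 / 2) * ‖v‖ ^ 2) := by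
          gcongr; exact norm_inner_le_norm _ _
      _ = ‖G‖ * (‖v‖ * Real.exp (-(1 / 2) * ‖v‖ ^ 2)) := by ring
      _ ≤ _ := by gcongr; nlinarith [sq_nonneg (‖v‖ - 1)]

end GaussianMoments

section Projection

variable {V : Type*} [NormedAddCommGroup V] [InnerProductSpace ℝ V]

theorem inner_le_zero_of_isNearest {X : Set V} (hX : Convex ℝ X) {w p : V} (hp : p ∈ X)
    (hmin : ∀ y ∈ X, ‖w - p‖ ≤ ‖w - y‖) : ∀ y ∈ X, ⟪w - p, y - p⟫_ℝ ≤ 0 := by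
  have : Nonempty X := ⟨⟨p, hp⟩⟩
  refine (norm_eq_iInf_iff_real_inner_le_zero hX hp).1 (le_antisymm ?_ ?_)
  · exact le_ciInf fun y ↦ hmin y y.2
  · exact ciInf_le (f := fun y : X ↦ ‖w - y‖) ⟨0, by rintro _ ⟨y, rfl⟩; positivity⟩ ⟨p, hp⟩

theorem lipschitzWith_one_of_isNearest {X : Set V} (hX : Convex ℝ X) {proj : V → V}
    (hproj : ∀ w, proj w ∈ X ∧ ∀ y ∈ X, ‖w - proj w‖ ≤ ‖w - y‖) : LipschitzWith 1 proj := by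
  refine LipschitzWith.of_dist_le_mul fun a b ↦ ?_
  rw [dist_eq_norm, dist_eq_norm, NNReal.coe_one, one_mul]
  have ha := inner_le_zero_of_isNearest hX (hproj a).1 (hproj a).2 _ (hproj b).1
  have hb := inner_le_zero_of_isNearest hX (hproj b).1 (hproj b).2 _ (hproj a).1
  have hsq : ‖proj a - proj b‖ ^ 2 ≤ ⟪a - b, proj a - proj b⟫_ℝ := by
    rw [← real_inner_self_eq_norm_sq]
    simp only [inner_sub_left, inner_sub_right] at *
    linarith
  have hcs := real_inner_le_norm (a - b) (proj a - proj b)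
  by_contra! hlt
  nlinarith [norm_nonneg (a - b), norm_nonneg (proj a - proj b)]

end Projection

section Smoothing

variable {n : ℕ}

local notation "E" => EuclideanSpace ℝ (Fin n)

theorem gaussKernel_eq_mul_rexp (ξ : ℝ) (z : E) :
    gaussKernel n ξ z =
      (2 * Real.pi * ξ ^ 2) ^ (-(n : ℝ) / 2) * Real.exp (-(1 / (2 * ξ ^ 2)) * ‖z‖ ^ 2) := by
  rw [gaussKernel]
  ring_nf

theorem gaussKernel_nonneg (ξ : ℝ) (z : E) : 0 ≤ gaussKernel n ξ z := by
  unfold gaussKernel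
  positivity

theorem continuous_gaussKernel (ξ : ℝ) : Continuous (gaussKernel n ξ) := by
  unfold gaussKernel
  fun_prop

theorem integrable_gaussKernel {ξ : ℝ} (hξ : 0 < ξ) : Integrable (gaussKernel n ξ) := by
  simp only [funext (gaussKernel_eq_mul_rexp (n := n) ξ)]
  exact (integrable_rexp_neg_mul_sq_norm (by positivity)).const_mul _

theorem hasGradientAt_gaussKernel_sub (ξ : ℝ) (x z : E) :
    HasGradientAt (fun x ↦ gaussKernel n ξ (x - z)) ((gaussKernel n ξ (x - z) / ξ ^ 2) • (z - x))
      x := by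
  rw [hasGradientAt_iff_hasFDerivAt]
  have h := ((((hasStrictFDerivAt_norm_sq (x - z)).hasFDerivAt.comp x
    ((hasFDerivAt_id x).sub_const z)).const_mul (-(1 / (2 * ξ ^ 2)))).exp).const_mul
    ((2 * Real.pi * ξ ^ 2) ^ (-(n : ℝ) / 2))
  simp only [gaussKernel_eq_mul_rexp]
  convert! h using 1
  ext w
  simp
  ring

/-- The gradient of the Gaussian kernel is dominated locally uniformly in the centre. -/
theorem gaussKernel_mul_norm_le {ξ : ℝ} {x₀ x : E} (hx : ‖x - x₀‖ ≤ 1) (z : E) :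
    gaussKernel n ξ (x - z) * ‖z - x‖ ≤
      2 * (2 * Real.pi * ξ ^ 2) ^ (-(n : ℝ) / 2) * Real.exp (1 / (2 * ξ ^ 2)) *
        ((1 + ‖z - x₀‖ ^ 2) * Real.exp (-(1 / (4 * ξ ^ 2)) * ‖z - x₀‖ ^ 2)) := by
  have h1 : ‖z - x‖ ≤ ‖z - x₀‖ + 1 := by
    rw [← sub_sub_sub_cancel_right z x x₀]
    exact (norm_sub_le _ _).trans (by gcongr)
  have h2 : ‖z - x₀‖ ≤ ‖z - x‖ + 1 := by
    rw [← sub_add_sub_cancel z x x₀]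
    exact (norm_add_le _ _).trans (by gcongr)
  have h3 : ‖z - x‖ ≤ 2 * (1 + ‖z - x₀‖ ^ 2) := by nlinarith [sq_nonneg (‖z - x₀‖ - 1)]
  have h4 : ‖z - x₀‖ ^ 2 ≤ 2 * ‖z - x‖ ^ 2 + 2 := by
    nlinarith [sq_nonneg (‖z - x‖ - 1), norm_nonneg (z - x₀)]
  have h5 : -(1 / (2 * ξ ^ 2)) * ‖z - x‖ ^ 2 ≤
      1 / (2 * ξ ^ 2) + -(1 / (4 * ξ ^ 2)) * ‖z - x₀‖ ^ 2 := by
    have := mul_le_mul_of_nonneg_left h4 (by positivity : 0 ≤ 1 / (4 * ξ ^ 2))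
    have e : 1 / (2 * ξ ^ 2) = 2 * (1 / (4 * ξ ^ 2)) := by ring
    rw [e]
    linarith
  rw [gaussKernel_eq_mul_rexp, norm_sub_rev x z]
  calc _ ≤ (2 * Real.pi * ξ ^ 2) ^ (-(n : ℝ) / 2) *
        Real.exp (1 / (2 * ξ ^ 2) + -(1 / (4 * ξ ^ 2)) * ‖z - x₀‖ ^ 2) *
          (2 * (1 + ‖z - x₀‖ ^ 2)) := by gcongr
    _ = _ := by rw [Real.exp_add]; ring

theorem hasGradientAt_gaussSmooth {φ : E → ℝ} (hφ : Measurable φ) {C : ℝ} (hC : ∀ z, |φ z| ≤ C)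
    {ξ : ℝ} (hξ : 0 < ξ) (x₀ : E) :
    HasGradientAt (gaussSmooth n ξ φ)
      (∫ z, (gaussKernel n ξ (x₀ - z) * φ z / ξ ^ 2) • (z - x₀)) x₀ := by
  have hC0 : 0 ≤ C := (abs_nonneg _).trans (hC 0)
  have hK := continuous_gaussKernel (n := n) ξ
  set A := 2 * (2 * Real.pi * ξ ^ 2) ^ (-(n : ℝ) / 2) * Real.exp (1 / (2 * ξ ^ 2))
  let bound : E → ℝ := fun z ↦ C / ξ ^ 2 * (A * ((1 + ‖z - x₀‖ ^ 2) *
    Real.exp (-(1 / (4 * ξ ^ 2)) * ‖z - x₀‖ ^ 2)))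
  have hbound_int : Integrable bound :=
    (((integrable_one_add_sq_norm_mul_rexp (V := E) (b := 1 / (4 * ξ ^ 2))
      (by positivity)).comp_sub_right x₀).const_mul A).const_mul _
  have hbound (z x : E) (hx : x ∈ Metric.ball x₀ 1) :
      ‖(gaussKernel n ξ (x - z) * φ z / ξ ^ 2) • (z - x)‖ ≤ bound z := by
    rw [norm_smul, norm_div, norm_mul, Real.norm_of_nonneg (gaussKernel_nonneg ξ (x - z)),
      Real.norm_of_nonneg (sq_nonneg ξ), Real.norm_eq_abs]
    calc gaussKernel n ξ (x - z) * |φ z| / ξ ^ 2 * ‖z - x‖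
        = |φ z| / ξ ^ 2 * (gaussKernel n ξ (x - z) * ‖z - x‖) := by ring
      _ ≤ _ := by
        refine mul_le_mul (by gcongr; exact hC z)
          (gaussKernel_mul_norm_le (by simpa [dist_eq_norm] using hx.le) z)
          (mul_nonneg (gaussKernel_nonneg ξ _) (norm_nonneg _)) (by positivity)
  have hmeas : AEStronglyMeasurable (fun z ↦ (gaussKernel n ξ (x₀ - z) * φ z / ξ ^ 2) • (z - x₀))
      volume := by fun_prop
  have hint : Integrable fun z ↦ (gaussKernel n ξ (x₀ - z) * φ z / ξ ^ 2) • (z - x₀) :=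
    hbound_int.mono' hmeas (.of_forall fun z ↦ hbound z x₀ (Metric.mem_ball_self one_pos))
  rw [hasGradientAt_iff_hasFDerivAt]
  have h := hasFDerivAt_integral_of_dominated_of_fderiv_le (𝕜 := ℝ) (μ := (volume : Measure E))
    (F := fun x z ↦ gaussKernel n ξ (x - z) * φ z) (bound := bound)
    (F' := fun x z ↦ InnerProductSpace.toDual ℝ E
      ((gaussKernel n ξ (x - z) * φ z / ξ ^ 2) • (z - x)))
    (Metric.ball_mem_nhds x₀ one_pos) (.of_forall fun x ↦ by fun_prop) ?_ ?_
    (.of_forall fun z x hx ↦ ?_) hbound_int (.of_forall fun z x _ ↦ ?_)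
  · refine h.congr_fderiv ?_
    exact ((InnerProductSpace.toDual ℝ E).toContinuousLinearEquiv.toContinuousLinearMap
      |>.integral_comp_comm hint)
  · refine (((integrable_gaussKernel (n := n) hξ).comp_sub_left x₀).const_mul C).mono'
      (by fun_prop) (.of_forall fun z ↦ ?_)
    rw [norm_mul, Real.norm_of_nonneg (gaussKernel_nonneg ξ _), mul_comm, Real.norm_eq_abs]
    exact mul_le_mul_of_nonneg_right (hC z) (gaussKernel_nonneg ξ _)
  · exact (InnerProductSpace.toDual ℝ E).continuous.comp_aestronglyMeasurable hmeas
  · rw [LinearIsometryEquiv.norm_map]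
    exact hbound z x hx
  · have := (hasGradientAt_iff_hasFDerivAt.1 (hasGradientAt_gaussKernel_sub ξ x z)).mul_const (φ z)
    refine this.congr_fderiv ?_
    ext w
    simp
    ring

theorem gaussKernel_smul {ξ : ℝ} (hξ : 0 < ξ) (u : E) :
    gaussKernel n ξ (ξ • u) = (ξ ^ n)⁻¹ * gaussKernel n 1 u := by
  have h : (2 * Real.pi * ξ ^ 2) ^ (-(n : ℝ) / 2) =
      (ξ ^ n)⁻¹ * (2 * Real.pi) ^ (-(n : ℝ) / 2) := by
    rw [Real.mul_rpow (by positivity) (by positivity), ← Real.rpow_natCast ξ 2, ← Real.rpow_mul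
      hξ.le, mul_comm, ← Real.rpow_natCast ξ n, ← Real.rpow_neg hξ.le]
    congr 2
    push_cast
    ring
  rw [gaussKernel, gaussKernel, h, norm_smul, Real.norm_of_nonneg hξ.le]
  have : -(ξ * ‖u‖) ^ 2 / (2 * ξ ^ 2) = -‖u‖ ^ 2 / (2 * 1 ^ 2) := by field
  simp only [this, one_pow, mul_one]
  ring

theorem gaussKernel_one (u : E) :
    gaussKernel n 1 u = (2 * Real.pi) ^ (-(n : ℝ) / 2) * Real.exp (-(1 / 2) * ‖u‖ ^ 2) := by
  simp [gaussKernel_eq_mul_rexp]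

theorem integral_gaussKernel_one_smul_id : ∫ u : E, gaussKernel n 1 u • u = 0 := by
  simp only [gaussKernel_one, mul_smul]
  rw [integral_smul, integral_rexp_neg_half_sq_norm_smul_id, smul_zero]

theorem integral_gaussKernel_one_mul_inner_smul_id (G : E) :
    ∫ u : E, (gaussKernel n 1 u * ⟪G, u⟫_ℝ) • u = G := by
  simp only [gaussKernel_one, mul_assoc, mul_smul _ (_ * _)]
  rw [integral_smul, integral_rexp_neg_half_sq_norm_mul_inner_smul_id,
    GaussianFourier.integral_rexp_neg_mul_sq_norm one_half_pos, smul_smul, finrank_euclideanSpace,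
    Fintype.card_fin, show Real.pi / (1 / 2) = 2 * Real.pi by ring, ← Real.rpow_add (by positivity),
    show -(n : ℝ) / 2 + n / 2 = 0 by ring, Real.rpow_zero, one_smul]

theorem integrable_one_add_sq_norm_mul_gaussKernel_one :
    Integrable fun u : E ↦ (1 + ‖u‖ ^ 2) * gaussKernel n 1 u := by
  refine ((integrable_one_add_sq_norm_mul_rexp (V := E) one_half_pos).const_mul
    ((2 * Real.pi) ^ (-(n : ℝ) / 2))).congr (.of_forall fun u ↦ ?_)
  simp only [gaussKernel_one]
  ring

theorem gradient_gaussSmooth_eq_integral {φ : E → ℝ} (hφ : Measurable φ) {C : ℝ}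
    (hC : ∀ z, |φ z| ≤ C) {ξ : ℝ} (hξ : 0 < ξ) (x : E) :
    gradient (gaussSmooth n ξ φ) x =
      ∫ u, (gaussKernel n 1 u * (φ (x + ξ • u) - φ x) / ξ) • u := by
  have hK := (continuous_gaussKernel (n := n) 1).measurable
  rw [(hasGradientAt_gaussSmooth hφ hC hξ x).gradient, ← integral_add_left_eq_self _ x]
  have hscale := Measure.integral_comp_smul_of_nonneg (volume : Measure E)
    (fun v ↦ (gaussKernel n ξ (x - (x + v)) * φ (x + v) / ξ ^ 2) • (x + v - x)) ξ (hR := hξ.le)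
  rw [finrank_euclideanSpace, Fintype.card_fin, eq_inv_smul_iff₀ (by positivity)] at hscale
  rw [← hscale, ← integral_smul]
  have hid : Integrable fun u : E ↦ gaussKernel n 1 u • u := by
    refine (integrable_one_add_sq_norm_mul_gaussKernel_one (n := n)).mono'
      (Measurable.aestronglyMeasurable (by fun_prop)) (.of_forall fun u ↦ ?_)
    have := gaussKernel_nonneg (n := n) 1 u
    rw [norm_smul, Real.norm_of_nonneg this, mul_comm]
    gcongr
    nlinarith [sq_nonneg (‖u‖ - 1)]
  have hφid : Integrable fun u : E ↦ (gaussKernel n 1 u * φ (x + ξ • u)) • u := by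
    refine (hid.norm.const_mul C).mono' (Measurable.aestronglyMeasurable (by fun_prop))
      (.of_forall fun u ↦ ?_)
    rw [norm_smul, norm_smul, norm_mul, mul_comm ‖gaussKernel n 1 u‖, mul_assoc]
    gcongr
    exact hC _
  calc _ = ∫ u : E, ξ⁻¹ • (gaussKernel n 1 u * φ (x + ξ • u)) • u := by
        congr 1 with u : 1
        have hsymm : gaussKernel n ξ (x - (x + ξ • u)) = gaussKernel n ξ (ξ • u) := by
          rw [sub_add_cancel_left, gaussKernel, gaussKernel, norm_neg]
        rw [hsymm, gaussKernel_smul hξ, add_sub_cancel_left, smul_smul, smul_smul, smul_smul]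
        congr 1
        field
    _ = ∫ u : E, (ξ⁻¹ • (gaussKernel n 1 u * φ (x + ξ • u)) • u -
          (ξ⁻¹ * φ x) • gaussKernel n 1 u • u) := by
        rw [integral_sub (hφid.fun_smul ξ⁻¹) (hid.fun_smul (ξ⁻¹ * φ x)),
          integral_smul (ξ⁻¹ * φ x), integral_gaussKernel_one_smul_id, smul_zero, sub_zero]
    _ = _ := by
        congr 1 with u : 1
        rw [smul_smul, smul_smul, ← sub_smul]
        congr 1
        ring

theorem exists_norm_sub_le_of_differentiableAt_of_bounded {V : Type*} [NormedAddCommGroup V]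
    [NormedSpace ℝ V] {φ : V → ℝ} {C : ℝ} (hC : ∀ z, |φ z| ≤ C) {x : V}
    (hd : DifferentiableAt ℝ φ x) : ∃ L, 0 ≤ L ∧ ∀ h, |φ (x + h) - φ x| ≤ L * ‖h‖ := by
  have hC0 : 0 ≤ C := (abs_nonneg _).trans (hC x)
  obtain ⟨c, hc0, hc⟩ := hd.isBigO_sub.exists_nonneg
  obtain ⟨ε, hε, hball⟩ := Metric.eventually_nhds_iff.1 hc.bound
  refine ⟨c + 2 * C / ε, by positivity, fun h ↦ ?_⟩
  rcases lt_or_ge ‖h‖ ε with hlt | hge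
  · have := hball (y := x + h) (by simpa [dist_eq_norm] using hlt)
    rw [add_sub_cancel_left, Real.norm_eq_abs] at this
    exact this.trans (by gcongr; exact le_add_of_nonneg_right (by positivity))
  · calc |φ (x + h) - φ x| ≤ C + C := (abs_sub _ _).trans (add_le_add (hC _) (hC _))
      _ = 2 * C / ε * ε := by field
      _ ≤ (c + 2 * C / ε) * ‖h‖ := by gcongr; exact le_add_of_nonneg_left hc0

theorem tendsto_gradient_gaussSmooth {φ : E → ℝ} (hφ : Measurable φ) {C : ℝ}
    (hC : ∀ z, |φ z| ≤ C) {x G : E} (hd : HasGradientAt φ G x) :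
    Filter.Tendsto (fun ξ : ℝ ↦ gradient (gaussSmooth n ξ φ) x)
      (nhdsWithin 0 (Set.Ioi 0)) (nhds G) := by
  have hK := (continuous_gaussKernel (n := n) 1).measurable
  obtain ⟨L, hL0, hL⟩ := exists_norm_sub_le_of_differentiableAt_of_bounded hC hd.differentiableAt
  suffices h : Filter.Tendsto
      (fun ξ : ℝ ↦ ∫ u, (gaussKernel n 1 u * (φ (x + ξ • u) - φ x) / ξ) • u)
      (nhdsWithin 0 (Set.Ioi 0)) (nhds (∫ u : E, (gaussKernel n 1 u * ⟪G, u⟫_ℝ) • u)) by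
    rw [integral_gaussKernel_one_mul_inner_smul_id] at h
    refine h.congr' ?_
    filter_upwards [self_mem_nhdsWithin] with ξ hξ
    exact (gradient_gaussSmooth_eq_integral hφ hC hξ x).symm
  refine tendsto_integral_filter_of_dominated_convergence
    (fun u ↦ L * ((1 + ‖u‖ ^ 2) * gaussKernel n 1 u))
    (.of_forall fun ξ ↦ Measurable.aestronglyMeasurable (by fun_prop))
    ?_ (integrable_one_add_sq_norm_mul_gaussKernel_one.const_mul L) (.of_forall fun u ↦ ?_)
  · filter_upwards [self_mem_nhdsWithin] with ξ hξ
    refine .of_forall fun u ↦ ?_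
    have hξ0 : 0 < ξ := hξ
    have hk := gaussKernel_nonneg (n := n) 1 u
    have hq : |φ (x + ξ • u) - φ x| ≤ L * (ξ * ‖u‖) := by
      simpa [norm_smul, abs_of_pos hξ0] using hL (ξ • u)
    rw [norm_smul, norm_div, norm_mul, Real.norm_of_nonneg hk, Real.norm_of_nonneg hξ0.le,
      Real.norm_eq_abs]
    calc _ ≤ gaussKernel n 1 u * (L * (ξ * ‖u‖)) / ξ * ‖u‖ := by gcongr
      _ = L * (‖u‖ ^ 2 * gaussKernel n 1 u) := by field
      _ ≤ _ := by gcongr; linarith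
  · have hline := (hd.hasFDerivAt.hasLineDerivAt u).tendsto_slope_zero_right
    refine Filter.Tendsto.smul_const ?_ u
    rw [InnerProductSpace.toDual_apply_apply] at hline
    refine (hline.const_mul (gaussKernel n 1 u)).congr fun ξ ↦ ?_
    rw [smul_eq_mul]
    ring

end Smoothing

/-- If the bounded measurable `φ` is differentiable at `x̄` with gradient `G`,
then `∇φ_ξ(x̄) → G` as `ξ → 0⁺`; consequently, for every nonempty closed convex `X` (with
`proj` its Euclidean nearest-point projection) and every `β > 0`, the projected gradient
mappings `P_X(x̄, ∇φ_ξ(x̄), β) = (x̄ - proj(x̄ - β ∇φ_ξ(x̄)))/β` converge to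
`P_X(x̄, G, β)` as `ξ → 0⁺`. -/
theorem stmt_4 (n : ℕ) (hn : 1 ≤ n) (φ : EuclideanSpace ℝ (Fin n) → ℝ)
    (hmeas : Measurable φ) (C : ℝ) (hbdd : ∀ z, |φ z| ≤ C)
    (xbar G : EuclideanSpace ℝ (Fin n)) (hdiff : HasGradientAt φ G xbar) :
    Filter.Tendsto (fun ξ : ℝ => gradient (gaussSmooth n ξ φ) xbar)
      (nhdsWithin 0 (Set.Ioi 0)) (nhds G) ∧
    ∀ (X : Set (EuclideanSpace ℝ (Fin n))), X.Nonempty → IsClosed X → Convex ℝ X →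
      ∀ proj : EuclideanSpace ℝ (Fin n) → EuclideanSpace ℝ (Fin n),
        (∀ w, proj w ∈ X ∧ ∀ y ∈ X, ‖w - proj w‖ ≤ ‖w - y‖) →
        ∀ β : ℝ, 0 < β →
          Filter.Tendsto
            (fun ξ : ℝ => β⁻¹ • (xbar - proj (xbar - β • gradient (gaussSmooth n ξ φ) xbar)))
            (nhdsWithin 0 (Set.Ioi 0))
            (nhds (β⁻¹ • (xbar - proj (xbar - β • G)))) := by
  have h := tendsto_gradient_gaussSmooth hmeas hbdd hdiff
  refine ⟨h, fun X _ _ hX proj hproj β _ ↦ ?_⟩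
  have hcont := (lipschitzWith_one_of_isNearest hX hproj).continuous
  exact ((hcont.tendsto _).comp ((h.const_smul β).const_sub xbar)).const_sub xbar |>.const_smul β⁻¹
end

section
/- Let n, m ≥ 1, let g : ℝ^n × ℝ^m → ℝ be twice continuously differentiable, let 𝒳 ⊆ ℝ^n be compact and let 𝒴' ⊆ ℝ^m be compact. Let X̃ = {x ∈ 𝒳 : there exists y ∈ ℝ^m with ∇_y g(x,y) = 0 and det ∇²_{yy} g(x,y) = 0} be the bifurcation set, and for δ > 0 set X̃_δ = {x ∈ 𝒳 : ∃ x' ∈ X̃, ‖x − x'‖ ≤ δ}. Then for every δ > 0 there exists μ > 0 such that for every x ∈ 𝒳 ∖ X̃_δ and every y ∈ 𝒴' with ∇_y g(x,y) = 0, one has ‖∇²_{yy} g(x,y) · v‖ ≥ μ ‖v‖ for all v ∈ ℝ^m; equivalently, every eigenvalue λ of the symmetric Hessian matrix ∇²_{yy} g(x,y) satisfies |λ| ≥ μ. -/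
open MeasureTheory

section Partial

variable {E F H : Type*} [NormedAddCommGroup E] [NormedSpace ℝ E]
  [NormedAddCommGroup F] [NormedSpace ℝ F] [NormedAddCommGroup H] [NormedSpace ℝ H]

theorem fderiv_partial_right {f : E × F → H} {x : E} {y : F}
    (hf : DifferentiableAt ℝ f (x, y)) :
    fderiv ℝ (fun y' => f (x, y')) y
      = (fderiv ℝ f (x, y)).comp (ContinuousLinearMap.inr ℝ E F) :=
  (hf.hasFDerivAt.comp y (hasFDerivAt_prodMk_right x y)).fderiv

theorem ContDiff.gradient_partial_right {F : Type*} [NormedAddCommGroup F]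
    [InnerProductSpace ℝ F] [CompleteSpace F] {g : E × F → ℝ} (hg : ContDiff ℝ 2 g) :
    ContDiff ℝ 1 (fun p : E × F => gradient (fun y' => g (p.1, y')) p.2) := by
  have h : (fun p : E × F => gradient (fun y' => g (p.1, y')) p.2) = fun p =>
      (InnerProductSpace.toDual ℝ F).symm
        ((fderiv ℝ g p).comp (ContinuousLinearMap.inr ℝ E F)) := by
    funext p
    rw [gradient, fderiv_partial_right (hg.differentiable (by norm_num) _)]
  rw [h]
  exact (InnerProductSpace.toDual ℝ F).symm.contDiff.comp
    ((hg.fderiv_right (m := 1) (by norm_num)).clm_comp contDiff_const)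

end Partial

theorem continuous_hessLM_partial_right {E : Type*} [NormedAddCommGroup E] [NormedSpace ℝ E]
    {m : ℕ} {g : E × EuclideanSpace ℝ (Fin m) → ℝ} (hg : ContDiff ℝ 2 g) :
    Continuous (fun p : (E × EuclideanSpace ℝ (Fin m)) × EuclideanSpace ℝ (Fin m) =>
      hessLM (fun y' => g (p.1.1, y')) p.1.2 p.2) := by
  have hG := hg.gradient_partial_right
  have h : (fun p : (E × EuclideanSpace ℝ (Fin m)) × EuclideanSpace ℝ (Fin m) =>
      hessLM (fun y' => g (p.1.1, y')) p.1.2 p.2) = fun p =>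
      fderiv ℝ (fun q : E × EuclideanSpace ℝ (Fin m) =>
        gradient (fun y' => g (q.1, y')) q.2) p.1 (0, p.2) := by
    funext p
    exact DFunLike.congr_fun
      (fderiv_partial_right (hG.differentiable one_ne_zero (p.1.1, p.1.2))) p.2
  rw [h]
  exact ((hG.continuous_fderiv one_ne_zero).comp continuous_fst).clm_apply
    (continuous_const.prodMk continuous_snd)

/-- Away from the `δ`-neighborhood of the bifurcation set, the Hessian
of `g(x,·)` at stationary points in a compact set `𝒴'` is uniformly non-degenerate: there
is `μ > 0` with `‖∇²_{yy} g(x,y) v‖ ≥ μ ‖v‖` for all `v` (equivalently all eigenvalues of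
the symmetric Hessian have absolute value at least `μ`). -/
theorem stmt_10 (n m : ℕ) (hn : 1 ≤ n) (hm : 1 ≤ m)
    (g : EuclideanSpace ℝ (Fin n) × EuclideanSpace ℝ (Fin m) → ℝ)
    (hg : ContDiff ℝ 2 g)
    (𝒳 : Set (EuclideanSpace ℝ (Fin n))) (h𝒳 : IsCompact 𝒳)
    (𝒴' : Set (EuclideanSpace ℝ (Fin m))) (h𝒴' : IsCompact 𝒴') :
    ∀ δ : ℝ, 0 < δ → ∃ μ : ℝ, 0 < μ ∧
      ∀ x ∈ 𝒳 \ {x ∈ 𝒳 | ∃ x' ∈ {x'' ∈ 𝒳 | ∃ y : EuclideanSpace ℝ (Fin m),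
            gradient (fun y' => g (x'', y')) y = 0 ∧
            LinearMap.det (hessLM (fun y' => g (x'', y')) y) = 0},
          ‖x - x'‖ ≤ δ},
        ∀ y ∈ 𝒴', gradient (fun y' => g (x, y')) y = 0 →
          ∀ v : EuclideanSpace ℝ (Fin m),
            μ * ‖v‖ ≤ ‖hessLM (fun y' => g (x, y')) y v‖ := by
  intro δ hδ
  set B : Set (EuclideanSpace ℝ (Fin n)) :=
    {x'' ∈ 𝒳 | ∃ y : EuclideanSpace ℝ (Fin m),
      gradient (fun y' => g (x'', y')) y = 0 ∧
      LinearMap.det (hessLM (fun y' => g (x'', y')) y) = 0}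
  let K : Set ((EuclideanSpace ℝ (Fin n) × EuclideanSpace ℝ (Fin m)) ×
      EuclideanSpace ℝ (Fin m)) :=
    ((𝒳 ×ˢ 𝒴') ×ˢ Metric.sphere 0 1) ∩
      ({p | gradient (fun y' => g (p.1.1, y')) p.1.2 = 0} ∩
        {p | ∀ x' ∈ B, δ ≤ ‖p.1.1 - x'‖})
  have hK : IsCompact K := by
    refine ((h𝒳.prod h𝒴').prod (isCompact_sphere 0 1)).inter_right (IsClosed.inter ?_ ?_)
    · exact isClosed_eq (hg.gradient_partial_right.continuous.comp continuous_fst)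
        continuous_const
    · simp only [Set.ofPred_forall]
      exact isClosed_iInter fun x' => isClosed_iInter fun _ =>
        isClosed_le continuous_const (by fun_prop)
  have hpos : ∀ p ∈ K, 0 < ‖hessLM (fun y' => g (p.1.1, y')) p.1.2 p.2‖ := by
    rintro ⟨⟨x, y⟩, v⟩ ⟨⟨⟨hx, hy⟩, hv⟩, hgrad, hfar⟩
    refine norm_pos_iff.2 fun hzero => ?_
    have hv0 : v ≠ 0 := by
      rintro rfl
      simp at hv
    have hdet : LinearMap.det (hessLM (fun y' => g (x, y')) y) = 0 := by
      by_contra hdet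
      exact hv0 ((LinearMap.ker_eq_bot'.1
        (LinearMap.equivOfDetNeZero _ hdet).ker) v hzero)
    have := hfar x ⟨hx, y, hgrad, hdet⟩
    simp at this
    linarith
  obtain ⟨μ, hμ, hmin⟩ := hK.exists_forall_le'
    (continuous_hessLM_partial_right hg).norm.continuousOn hpos
  refine ⟨μ, hμ, fun x hx y hy hgrad v => ?_⟩
  rcases eq_or_ne v 0 with rfl | hv
  · simp
  have hv' : 0 < ‖v‖ := norm_pos_iff.2 hv
  have hfar : ∀ x' ∈ B, δ ≤ ‖x - x'‖ := fun x' hx' =>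
    le_of_not_ge fun hle => hx.2 ⟨hx.1, x', hx', hle⟩
  have h := hmin ((x, y), ‖v‖⁻¹ • v)
    ⟨⟨⟨hx.1, hy⟩, by simp [norm_smul, hv'.ne']⟩, hgrad, hfar⟩
  rw [map_smul, norm_smul, norm_inv, norm_norm, inv_mul_eq_div, le_div_iff₀ hv'] at h
  exact h
end

section
/- Let n, m ≥ 1, let g : ℝ^n × ℝ^m → ℝ be twice continuously differentiable, let 𝒳 ⊆ ℝ^n be compact, and let 𝒴, 𝒴' ⊆ ℝ^m be compact sets with 𝒴 contained in the topological interior of 𝒴'. Let X̃ = {x ∈ 𝒳 : there exists y ∈ ℝ^m with ∇_y g(x,y) = 0 and det ∇²_{yy} g(x,y) = 0}, for δ > 0 set X̃_δ = {x ∈ 𝒳 : ∃ x' ∈ X̃, ‖x − x'‖ ≤ δ}, and for x ∈ 𝒳 set Crit(x) = {y ∈ 𝒴' : ∇_y g(x,y) = 0}. Then for every δ > 0 and every r > 0 there exists α > 0 such that ‖∇_y g(x,y)‖ ≥ α for every x ∈ 𝒳 ∖ X̃_δ and every y ∈ 𝒴 satisfying ‖y − y'‖ ≥ r for all y' ∈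 Crit(x). -/
open MeasureTheory

/-- The partial gradient of a `C²` function in its second variable is `C¹` jointly. -/
lemma contDiff_partial_gradient {E F : Type*} [NormedAddCommGroup E] [NormedSpace ℝ E]
    [NormedAddCommGroup F] [InnerProductSpace ℝ F] [CompleteSpace F]
    {g : E × F → ℝ} (hg : ContDiff ℝ 2 g) :
    ContDiff ℝ 1 (fun p : E × F => gradient (fun y => g (p.1, y)) p.2) := by
  have h : (fun p : E × F => gradient (fun y => g (p.1, y)) p.2) = fun p =>
      (InnerProductSpace.toDual ℝ F).symm ((fderiv ℝ g p).comp (ContinuousLinearMap.inr ℝ E F)) := by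
    funext p
    have hgp : HasFDerivAt g (fderiv ℝ g p) (p.1, p.2) :=
      (hg.differentiable (by norm_num) p).hasFDerivAt
    have h := hgp.comp p.2 (hasFDerivAt_prodMk_right (𝕜 := ℝ) p.1 p.2)
    exact congrArg _ h.fderiv
  rw [h]
  exact (InnerProductSpace.toDual ℝ F).symm.contDiff.comp
    ((hg.fderiv_right (by norm_num)).clm_comp contDiff_const)

/-- A zero of `f (x₀, ·)` with surjective partial derivative persists, inside any prescribed
neighbourhood, for all parameters close to `x₀`. -/
lemma HasStrictFDerivAt.eventually_exists_zero {E F G : Type*}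
    [NormedAddCommGroup E] [NormedSpace ℝ E] [CompleteSpace E]
    [NormedAddCommGroup F] [NormedSpace ℝ F] [CompleteSpace F]
    [NormedAddCommGroup G] [NormedSpace ℝ G] [CompleteSpace G]
    {f : E × F → G} {f' : E × F →L[ℝ] G} {x₀ : E} {y₀ : F}
    (hf : HasStrictFDerivAt f f' (x₀, y₀)) (h₀ : f (x₀, y₀) = 0)
    (hsurj : Function.Surjective fun y : F => f' (0, y)) {V : Set F} (hV : V ∈ nhds y₀) :
    ∀ᶠ x in nhds x₀, ∃ y ∈ V, f (x, y) = 0 := by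
  have hΦ : HasStrictFDerivAt (fun p : E × F => (p.1, f p))
      ((ContinuousLinearMap.fst ℝ E F).prod f') (x₀, y₀) :=
    hasStrictFDerivAt_fst.prodMk hf
  have hrange : ((ContinuousLinearMap.fst ℝ E F).prod f').range = ⊤ := by
    refine LinearMap.range_eq_top.2 fun ⟨x, z⟩ => ?_
    obtain ⟨y, hy⟩ := hsurj (z - f' (x, 0))
    refine ⟨(x, y), Prod.ext rfl ?_⟩
    have hxy : ((x, y) : E × F) = (x, 0) + (0, y) := by simp
    change f' (x, y) = z
    rw [hxy, map_add]
    simp only at hy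
    rw [hy, add_sub_cancel]
  have hmap := hΦ.map_nhds_eq_of_surj hrange
  have hN : Set.univ ×ˢ V ∈ nhds (x₀, y₀) := prod_mem_nhds Filter.univ_mem hV
  have himg := Filter.image_mem_map (m := fun p : E × F => (p.1, f p)) hN
  rw [hmap, h₀] at himg
  have hcont : Filter.Tendsto (fun x : E => (x, (0 : G))) (nhds x₀) (nhds (x₀, 0)) :=
    (Continuous.prodMk_left (0 : G)).tendsto x₀
  filter_upwards [hcont himg] with x hx
  obtain ⟨⟨x', y⟩, ⟨-, hy⟩, hxy⟩ := hx
  simp only [Prod.mk.injEq] at hxy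
  obtain ⟨rfl, hxy⟩ := hxy
  exact ⟨y, hy, hxy⟩

/-- Away from the `δ`-neighborhood of the bifurcation set and away from
the `r`-neighborhood of the critical set `Crit(x) = {y ∈ 𝒴' : ∇_y g(x,y) = 0}`, the
gradient norm `‖∇_y g(x,y)‖` is uniformly bounded below by some `α > 0`. -/
theorem stmt_11 (n m : ℕ) (hn : 1 ≤ n) (hm : 1 ≤ m)
    (g : EuclideanSpace ℝ (Fin n) × EuclideanSpace ℝ (Fin m) → ℝ)
    (hg : ContDiff ℝ 2 g)
    (𝒳 : Set (EuclideanSpace ℝ (Fin n))) (h𝒳 : IsCompact 𝒳)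
    (𝒴 𝒴' : Set (EuclideanSpace ℝ (Fin m))) (h𝒴 : IsCompact 𝒴) (h𝒴' : IsCompact 𝒴')
    (h𝒴𝒴' : 𝒴 ⊆ interior 𝒴') :
    ∀ δ : ℝ, 0 < δ → ∀ r : ℝ, 0 < r → ∃ α : ℝ, 0 < α ∧
      ∀ x ∈ 𝒳 \ {x ∈ 𝒳 | ∃ x' ∈ {x'' ∈ 𝒳 | ∃ y : EuclideanSpace ℝ (Fin m),
            gradient (fun y' => g (x'', y')) y = 0 ∧
            LinearMap.det (hessLM (fun y' => g (x'', y')) y) = 0},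
          ‖x - x'‖ ≤ δ},
        ∀ y ∈ 𝒴,
          (∀ y' ∈ {y'' ∈ 𝒴' | gradient (fun y₀ => g (x, y₀)) y'' = 0}, r ≤ ‖y - y'‖) →
          α ≤ ‖gradient (fun y' => g (x, y')) y‖ := by
  intro δ hδ r hr
  set F : EuclideanSpace ℝ (Fin n) × EuclideanSpace ℝ (Fin m) → EuclideanSpace ℝ (Fin m) :=
    fun p => gradient (fun y => g (p.1, y)) p.2 with hFdef
  have hF : ContDiff ℝ 1 F := contDiff_partial_gradient hg
  let P : ℝ → EuclideanSpace ℝ (Fin n) × EuclideanSpace ℝ (Fin m) → Prop := fun α p =>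
    p.1 ∈ 𝒳 →
    (∀ x' ∈ 𝒳, (∃ y, F (x', y) = 0 ∧ LinearMap.det (hessLM (fun y' => g (x', y')) y) = 0) →
      δ < ‖p.1 - x'‖) →
    (∀ y' ∈ 𝒴', F (p.1, y') = 0 → r ≤ ‖p.2 - y'‖) → α ≤ ‖F p‖
  have key : ∀ᶠ α in nhds (0 : ℝ), ∀ p ∈ 𝒳 ×ˢ 𝒴, P α p := by
    refine (h𝒳.prod h𝒴).eventually_forall_of_forall_eventually ?_
    rintro ⟨x₀, y₀⟩ ⟨hx₀, hy₀⟩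
    rw [nhds_prod_eq]
    by_cases h0 : F (x₀, y₀) = 0
    · by_cases hdet : LinearMap.det (hessLM (fun y' => g (x₀, y')) y₀) = 0
      · have hball : ∀ᶠ p in nhds (x₀, y₀), ‖p.1 - x₀‖ < δ := by
          have : Continuous fun p : EuclideanSpace ℝ (Fin n) × EuclideanSpace ℝ (Fin m) =>
            ‖p.1 - x₀‖ := by fun_prop
          exact this.continuousAt.eventually_lt continuousAt_const (by simpa using hδ)
        filter_upwards [hball.prod_inr (nhds 0)] with q hq _ hfar _
        exact absurd (hfar x₀ hx₀ ⟨y₀, h0, hdet⟩) hq.le.not_gt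
      · have hstrict : HasStrictFDerivAt F (fderiv ℝ F (x₀, y₀)) (x₀, y₀) :=
          hF.contDiffAt.hasStrictFDerivAt (by norm_num)
        have hpart := hstrict.hasFDerivAt.comp y₀ (hasFDerivAt_prodMk_right (𝕜 := ℝ) x₀ y₀)
        have hhess : ∀ v, hessLM (fun y' => g (x₀, y')) y₀ v = fderiv ℝ F (x₀, y₀) (0, v) :=
          fun v => congrArg (fun L => L v) hpart.fderiv
        have hsurj : Function.Surjective fun v => fderiv ℝ F (x₀, y₀) (0, v) := by
          intro z
          obtain ⟨v, hv⟩ := ((LinearMap.isUnit_iff_range_eq_top _).1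
            ((LinearMap.isUnit_iff_isUnit_det _).2 (isUnit_iff_ne_zero.2 hdet))).ge
              (Submodule.mem_top (x := z))
          exact ⟨v, (hhess v).symm.trans hv⟩
        have hV : 𝒴' ∩ Metric.ball y₀ (r / 2) ∈ nhds y₀ :=
          Filter.inter_mem (mem_interior_iff_mem_nhds.1 (h𝒴𝒴' hy₀))
            (Metric.ball_mem_nhds _ (half_pos hr))
        have hzero := hstrict.eventually_exists_zero h0 hsurj hV
        have hnear : ∀ᶠ y in nhds y₀, y ∈ Metric.ball y₀ (r / 2) :=
          Metric.ball_mem_nhds _ (half_pos hr)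
        have hev := hzero.prod_mk hnear
        rw [← nhds_prod_eq] at hev
        filter_upwards [hev.prod_inr (nhds 0)] with q hq _ _ hfar
        obtain ⟨⟨y', ⟨hy', hball⟩, hzero'⟩, hq2⟩ := hq
        have hle := hfar y' hy' hzero'
        rw [← dist_eq_norm] at hle
        have := dist_triangle_right q.2.2 y' y₀
        rw [Metric.mem_ball] at hball hq2
        linarith
    · have hlt : ∀ᶠ q : ℝ × (EuclideanSpace ℝ (Fin n) × EuclideanSpace ℝ (Fin m)) in
          nhds (0, (x₀, y₀)), q.1 < ‖F q.2‖ :=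
        continuousAt_fst.eventually_lt
          (hF.continuous.norm.comp continuous_snd).continuousAt (norm_pos_iff.2 h0)
      rw [← nhds_prod_eq]
      filter_upwards [hlt] with q hq _ _ _
      exact hq.le
  obtain ⟨α, hα, hpos⟩ :=
    ((key.filter_mono nhdsWithin_le_nhds).and (self_mem_nhdsWithin (s := Set.Ioi (0 : ℝ)))).exists
  refine ⟨α, hpos, fun x hx y hy hfar => ?_⟩
  refine hα (x, y) ⟨hx.1, hy⟩ hx.1 (fun x' hx' hdeg => ?_) fun y' hy' h => hfar y' ⟨hy', h⟩
  by_contra hle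
  exact hx.2 ⟨hx.1, x', ⟨hx', hdeg⟩, not_lt.1 hle⟩
end

section
/- Let X ⊆ ℝ^n be a nonempty closed convex set, let L ≥ 0, and let φ : ℝ^n → ℝ be differentiable with ∇φ L-Lipschitz on ℝ^n. Let x ∈ X, g̃ ∈ ℝ^n and β > 0. Define x⁺ = proj_X(x − β g̃), Φ̃ = (x − x⁺)/β, Φ = P_X(x, ∇φ(x), β), and γ = g̃ − ∇φ(x). Then the one-step descent inequality holds: φ(x⁺) ≤ φ(x) − (β − Lβ²/2) ‖Φ̃‖² + β ⟨γ, Φ⟩ + β ‖γ‖². -/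
open scoped RealInnerProductSpace

/-- The descent lemma: a function with `L`-Lipschitz gradient is bounded above by its quadratic
model. -/
theorem le_add_inner_gradient_add_sq {F : Type*} [NormedAddCommGroup F] [InnerProductSpace ℝ F]
    [CompleteSpace F] {φ : F → ℝ} {L : ℝ} (hφ : Differentiable ℝ φ)
    (hLip : ∀ a b, ‖gradient φ a - gradient φ b‖ ≤ L * ‖a - b‖) (a d : F) :
    φ (a + d) ≤ φ a + ⟪gradient φ a, d⟫ + L / 2 * ‖d‖ ^ 2 := by
  have hder (t : ℝ) : HasDerivAt
      (fun s : ℝ => φ (a + s • d) - s * ⟪gradient φ a, d⟫ - s ^ 2 * (L / 2 * ‖d‖ ^ 2))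
      (⟪gradient φ (a + t • d), d⟫ - ⟪gradient φ a, d⟫ - t * (L * ‖d‖ ^ 2)) t := by
    have hline : HasDerivAt (fun s : ℝ => a + s • d) d t := by
      simpa using ((hasDerivAt_id t).smul_const d).const_add a
    have hcomp := (hφ (a + t • d)).hasGradientAt.hasFDerivAt.comp_hasDerivAt t hline
    rw [InnerProductSpace.toDual_apply_apply] at hcomp
    refine ((hcomp.sub ((hasDerivAt_id t).mul_const ⟪gradient φ a, d⟫)).sub
      ((hasDerivAt_pow 2 t).mul_const (L / 2 * ‖d‖ ^ 2))).congr_deriv ?_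
    norm_num
    ring
  have hanti := antitoneOn_of_deriv_nonpos (convex_Icc (0 : ℝ) 1)
    (fun t _ => (hder t).continuousAt.continuousWithinAt)
    (fun t _ => (hder t).differentiableAt.differentiableWithinAt) (fun t ht => by
      rw [interior_Icc] at ht
      rw [(hder t).deriv, ← inner_sub_left]
      have hgrad : ‖gradient φ (a + t • d) - gradient φ a‖ ≤ L * (t * ‖d‖) := by
        simpa [norm_smul, abs_of_pos ht.1] using hLip (a + t • d) a
      nlinarith [real_inner_le_norm (gradient φ (a + t • d) - gradient φ a) d,
        mul_le_mul_of_nonneg_right hgrad (norm_nonneg d)])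
  have h01 := hanti (Set.left_mem_Icc.2 zero_le_one) (Set.right_mem_Icc.2 zero_le_one) zero_le_one
  simp only [one_smul, zero_smul, add_zero] at h01
  linarith

/-- The variational inequality satisfied by a nearest point of a convex set. -/
theorem Convex.inner_sub_le_zero_of_forall_norm_le {F : Type*} [NormedAddCommGroup F]
    [InnerProductSpace ℝ F] {X : Set F} (hX : Convex ℝ X) {w p : F} (hp : p ∈ X)
    (hmin : ∀ y ∈ X, ‖w - p‖ ≤ ‖w - y‖) {y : F} (hy : y ∈ X) : ⟪w - p, y - p⟫ ≤ 0 := by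
  refine (norm_eq_iInf_iff_real_inner_le_zero hX hp).1 (le_antisymm ?_ ?_) y hy
  · have : Nonempty X := ⟨⟨p, hp⟩⟩
    exact le_ciInf fun z => hmin z z.2
  · exact ciInf_le (f := fun z : X => ‖w - z‖)
      ⟨0, Set.forall_mem_range.2 fun _ => norm_nonneg _⟩ ⟨p, hp⟩

/-- One-step descent inequality for projected (inexact) gradient steps:
with `x⁺ = proj_X(x - β g̃)`, `Φ̃ = (x - x⁺)/β`, `Φ = P_X(x, ∇φ(x), β)` and
`γ = g̃ - ∇φ(x)`, if `∇φ` is `L`-Lipschitz then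
`φ(x⁺) ≤ φ(x) - (β - Lβ²/2) ‖Φ̃‖² + β ⟪γ, Φ⟫ + β ‖γ‖²`. -/
theorem stmt_15 (n : ℕ) (hn : 1 ≤ n)
    (X : Set (EuclideanSpace ℝ (Fin n))) (hXne : X.Nonempty)
    (hXcl : IsClosed X) (hXconv : Convex ℝ X)
    (proj : EuclideanSpace ℝ (Fin n) → EuclideanSpace ℝ (Fin n))
    (hproj : ∀ w, proj w ∈ X ∧ ∀ y ∈ X, ‖w - proj w‖ ≤ ‖w - y‖)
    (L : ℝ) (hL : 0 ≤ L)
    (φ : EuclideanSpace ℝ (Fin n) → ℝ) (hφ : Differentiable ℝ φ)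
    (hLip : ∀ a b, ‖gradient φ a - gradient φ b‖ ≤ L * ‖a - b‖)
    (x : EuclideanSpace ℝ (Fin n)) (hx : x ∈ X)
    (gtil : EuclideanSpace ℝ (Fin n)) (β : ℝ) (hβ : 0 < β) :
    φ (proj (x - β • gtil))
      ≤ φ x - (β - L * β ^ 2 / 2) * ‖β⁻¹ • (x - proj (x - β • gtil))‖ ^ 2
        + β * ⟪gtil - gradient φ x, β⁻¹ • (x - proj (x - β • gradient φ x))⟫
        + β * ‖gtil - gradient φ x‖ ^ 2 := by
  obtain ⟨hpX, hpmin⟩ := hproj (x - β • gtil)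
  obtain ⟨hqX, hqmin⟩ := hproj (x - β • gradient φ x)
  set p := proj (x - β • gtil)
  set q := proj (x - β • gradient φ x)
  have hdesc := le_add_inner_gradient_add_sq hφ hLip x (p - x)
  rw [add_sub_cancel] at hdesc
  set g := gradient φ x
  have hpx := hXconv.inner_sub_le_zero_of_forall_norm_le hpX hpmin hx
  have hpq := hXconv.inner_sub_le_zero_of_forall_norm_le hpX hpmin hqX
  have hqp := hXconv.inner_sub_le_zero_of_forall_norm_le hqX hqmin hpX
  obtain ⟨u, hu⟩ : ∃ u, u = x - p := ⟨_, rfl⟩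
  obtain ⟨v, hv⟩ : ∃ v, v = x - q := ⟨_, rfl⟩
  obtain ⟨γ, hγ⟩ : ∃ γ, γ = gtil - g := ⟨_, rfl⟩
  have hgtil : gtil = g + γ := by rw [hγ]; abel
  rw [show p - x = -u by rw [hu]; abel, norm_neg, inner_neg_right] at hdesc
  rw [← hu, show x - β • gtil - p = u - β • (g + γ) by rw [hu, hgtil]; abel] at hpx
  rw [show q - p = u - v by rw [hu, hv]; abel,
    show x - β • gtil - p = u - β • (g + γ) by rw [hu, hgtil]; abel] at hpq
  rw [show p - q = v - u by rw [hu, hv]; abel,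
    show x - β • g - q = v - β • g by rw [hv]; abel] at hqp
  rw [← hu, ← hv, ← hγ, norm_smul, mul_pow, inner_smul_right, Real.norm_eq_abs, sq_abs]
  have hsq := real_inner_self_nonneg (x := u - v - β • γ)
  simp only [inner_sub_left, inner_sub_right, inner_add_left, real_inner_smul_left,
    real_inner_smul_right, real_inner_self_eq_norm_sq, real_inner_comm u v,
    real_inner_comm γ u, real_inner_comm γ v, norm_smul, mul_pow,
    Real.norm_eq_abs, sq_abs] at hpx hpq hqp hsq
  have hcross : β * (β * ‖γ‖ ^ 2 - ⟪γ, u⟫ + ⟪γ, v⟫) ≥ 0 := by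
    linarith
  have hcross' := nonneg_of_mul_nonneg_right hcross hβ
  have hgrad : ‖u‖ ^ 2 / β ≤ ⟪g, u⟫ + ⟪γ, u⟫ := by
    rw [div_le_iff₀ hβ]
    linarith
  have hcoef : (β - L * β ^ 2 / 2) * (β⁻¹ ^ 2 * ‖u‖ ^ 2) = ‖u‖ ^ 2 / β - L / 2 * ‖u‖ ^ 2 := by
    field_simp
  rw [hcoef, mul_inv_cancel_left₀ hβ.ne']
  linarith
end

section
/- Let X ⊆ ℝ^n be a nonempty closed convex set, let L > 0 and f̄ ≥ 0, and let φ : ℝ^n → ℝ be differentiable with ∇φ L-Lipschitz on ℝ^n and |φ(x)| ≤ f̄ for every x ∈ X. Let T ≥ 1, let x₁ ∈ X, let g̃₁, …, g̃_T ∈ ℝ^n, let step sizes satisfy 0 < β_t ≤ 1/L, and define iterates x_{t+1} = proj_X(x_t − β_t g̃_t) for t = 1, …, T. With Φ̃_t = (x_t − x_{t+1})/β_t, Φ_t = P_X(x_t, ∇φ(x_t), β_t), and γ_t = g̃_t − ∇φ(x_t), one has Σ_{t=1}^T (β_t − L β_t²) ‖Φ̃_t‖² ≤ 2 f̄ + Σ_{t=1}^T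 β_t (⟨γ_t, Φ_t⟩ + ‖γ_t‖²). -/
open scoped RealInnerProductSpace

section ProjectedGradient

variable {E : Type*} [NormedAddCommGroup E] [InnerProductSpace ℝ E]

/-- The variational inequality satisfied by a nearest point of a convex set. -/
lemma inner_sub_le_zero_of_forall_norm_sub_le {X : Set E} (hX : Convex ℝ X) {u p : E}
    (hp : p ∈ X) (hmin : ∀ y ∈ X, ‖u - p‖ ≤ ‖u - y‖) {y : E} (hy : y ∈ X) :
    ⟪u - p, y - p⟫ ≤ 0 := by
  refine (norm_eq_iInf_iff_real_inner_le_zero hX hp).1 (le_antisymm ?_ ?_) y hy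
  · have : Nonempty X := ⟨⟨p, hp⟩⟩
    exact le_ciInf fun w => hmin w w.2
  · exact ciInf_le ⟨0, by rintro _ ⟨w, rfl⟩; exact norm_nonneg _⟩ (⟨p, hp⟩ : X)

/-- A descent inequality (with constant `L` instead of `L / 2`) for a function with
`L`-Lipschitz gradient. -/
lemma le_add_inner_gradient_add_mul_norm_sq [CompleteSpace E] {φ : E → ℝ}
    (hφ : Differentiable ℝ φ) {L : ℝ} (hL : 0 ≤ L)
    (hLip : ∀ a b, ‖gradient φ a - gradient φ b‖ ≤ L * ‖a - b‖) (x y : E) :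
    φ y ≤ φ x + ⟪gradient φ x, y - x⟫ + L * ‖y - x‖ ^ 2 := by
  obtain ⟨z, hz, hzeq⟩ := domain_mvt (s := Set.univ)
    (fun w _ => (hφ w).hasGradientAt.hasFDerivAt.hasFDerivWithinAt)
    convex_univ (Set.mem_univ x) (Set.mem_univ y)
  rw [InnerProductSpace.toDual_apply_apply] at hzeq
  have hzx : ‖z - x‖ ≤ ‖y - x‖ := norm_sub_le_of_mem_segment hz
  have hinner : ⟪gradient φ z - gradient φ x, y - x⟫ ≤ L * ‖y - x‖ * ‖y - x‖ :=
    (real_inner_le_norm _ _).trans <| mul_le_mul_of_nonneg_right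
      ((hLip z x).trans (mul_le_mul_of_nonneg_left hzx hL)) (norm_nonneg _)
  rw [inner_sub_left] at hinner
  linarith

/-- Perturbing the direction of a projected step by `γ` moves the projected point so that its
displacement has inner product at most `β * ‖γ‖ ^ 2` with `γ`. -/
lemma inner_sub_proj_sub_le {X : Set E} (hX : Convex ℝ X) {proj : E → E}
    (hproj : ∀ w, proj w ∈ X ∧ ∀ y ∈ X, ‖w - proj w‖ ≤ ‖w - y‖)
    {β : ℝ} (hβ : 0 < β) (x g h : E) :
    ⟪g - h, proj (x - β • h) - proj (x - β • g)⟫ ≤ β * ‖g - h‖ ^ 2 := by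
  set p := proj (x - β • g)
  set q := proj (x - β • h)
  have hp := inner_sub_le_zero_of_forall_norm_sub_le hX (hproj (x - β • g)).1
    (hproj (x - β • g)).2 (hproj (x - β • h)).1
  have hq := inner_sub_le_zero_of_forall_norm_sub_le hX (hproj (x - β • h)).1
    (hproj (x - β • h)).2 (hproj (x - β • g)).1
  have hfirm : ‖q - p‖ ^ 2 ≤ β * ⟪g - h, q - p⟫ := by
    have key : ‖q - p‖ ^ 2 - β * ⟪g - h, q - p⟫
        = ⟪x - β • g - p, q - p⟫ + ⟪x - β • h - q, p - q⟫ := by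
      rw [← neg_sub q p, inner_neg_right, ← sub_eq_add_neg, ← inner_sub_left,
        ← real_inner_self_eq_norm_sq, ← real_inner_smul_left, ← inner_sub_left]
      congr 1
      module
    linarith
  have hsq : 0 ≤ ‖β • (g - h) - (q - p)‖ ^ 2 := sq_nonneg _
  rw [norm_sub_sq_real, norm_smul, Real.norm_of_nonneg hβ.le, real_inner_smul_left] at hsq
  refine le_of_mul_le_mul_left ?_ hβ
  linarith

/-- One-step descent estimate for an inexact projected gradient step. -/
lemma projected_gradient_step_le [CompleteSpace E] {X : Set E} (hX : Convex ℝ X) {proj : E → E}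
    (hproj : ∀ w, proj w ∈ X ∧ ∀ y ∈ X, ‖w - proj w‖ ≤ ‖w - y‖) {φ : E → ℝ}
    (hφ : Differentiable ℝ φ) {L : ℝ} (hL : 0 ≤ L)
    (hLip : ∀ a b, ‖gradient φ a - gradient φ b‖ ≤ L * ‖a - b‖)
    {β : ℝ} (hβ : 0 < β) {x : E} (hx : x ∈ X) (g : E) :
    (β - L * β ^ 2) * ‖β⁻¹ • (x - proj (x - β • g))‖ ^ 2
      ≤ φ x - φ (proj (x - β • g))
        + β * (⟪g - gradient φ x, β⁻¹ • (x - proj (x - β • gradient φ x))⟫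
          + ‖g - gradient φ x‖ ^ 2) := by
  have hdesc := le_add_inner_gradient_add_mul_norm_sq hφ hL hLip x (proj (x - β • g))
  have hpert := inner_sub_proj_sub_le hX hproj hβ x g (gradient φ x)
  have hvar := inner_sub_le_zero_of_forall_norm_sub_le hX (hproj (x - β • g)).1
    (hproj (x - β • g)).2 hx
  set p := proj (x - β • g)
  set q := proj (x - β • gradient φ x)
  rw [sub_right_comm, inner_sub_left, real_inner_self_eq_norm_sq, real_inner_smul_left] at hvar
  have hdiv : β⁻¹ * ‖x - p‖ ^ 2 ≤ ⟪g, x - p⟫ := by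
    rw [inv_mul_le_iff₀ hβ]
    linarith
  rw [norm_sub_rev p x, ← neg_sub x p, inner_neg_right] at hdesc
  have hsplit : ⟪g - gradient φ x, q - p⟫
      = ⟪g, x - p⟫ - ⟪gradient φ x, x - p⟫ - ⟪g - gradient φ x, x - q⟫ := by
    rw [← inner_sub_left, ← inner_sub_right]
    congr 1
    abel
  have hlhs : (β - L * β ^ 2) * ‖β⁻¹ • (x - p)‖ ^ 2
      = β⁻¹ * ‖x - p‖ ^ 2 - L * ‖x - p‖ ^ 2 := by
    rw [norm_smul, Real.norm_of_nonneg (inv_nonneg.2 hβ.le)]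
    field_simp
  rw [hlhs, real_inner_smul_right, mul_add, mul_inv_cancel_left₀ hβ.ne']
  linarith

end ProjectedGradient

/-- Telescoped descent bound for projected (inexact) gradient iterations:
if `x_{t+1} = proj_X(x_t - β_t g̃_t)` with `0 < β_t ≤ 1/L`, `|φ| ≤ f̄` on `X` and `∇φ`
`L`-Lipschitz, then with `Φ̃_t = (x_t - x_{t+1})/β_t`, `Φ_t = P_X(x_t, ∇φ(x_t), β_t)` and
`γ_t = g̃_t - ∇φ(x_t)`,
`Σ_{t=1}^T (β_t - L β_t²) ‖Φ̃_t‖² ≤ 2 f̄ + Σ_{t=1}^T β_t (⟪γ_t, Φ_t⟫ + ‖γ_t‖²)`. -/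
theorem stmt_16 (n : ℕ) (hn : 1 ≤ n)
    (X : Set (EuclideanSpace ℝ (Fin n))) (hXne : X.Nonempty)
    (hXcl : IsClosed X) (hXconv : Convex ℝ X)
    (proj : EuclideanSpace ℝ (Fin n) → EuclideanSpace ℝ (Fin n))
    (hproj : ∀ w, proj w ∈ X ∧ ∀ y ∈ X, ‖w - proj w‖ ≤ ‖w - y‖)
    (L : ℝ) (hL : 0 < L) (fbar : ℝ) (hfbar : 0 ≤ fbar)
    (φ : EuclideanSpace ℝ (Fin n) → ℝ) (hφ : Differentiable ℝ φ)
    (hLip : ∀ a b, ‖gradient φ a - gradient φ b‖ ≤ L * ‖a - b‖)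
    (hφbdd : ∀ x ∈ X, |φ x| ≤ fbar)
    (T : ℕ) (hT : 1 ≤ T)
    (x : ℕ → EuclideanSpace ℝ (Fin n)) (hx1 : x 1 ∈ X)
    (gtil : ℕ → EuclideanSpace ℝ (Fin n)) (β : ℕ → ℝ)
    (hβ : ∀ t ∈ Finset.Icc 1 T, 0 < β t ∧ β t ≤ 1 / L)
    (hiter : ∀ t ∈ Finset.Icc 1 T, x (t + 1) = proj (x t - β t • gtil t)) :
    ∑ t ∈ Finset.Icc 1 T,
        (β t - L * β t ^ 2) * ‖(β t)⁻¹ • (x t - x (t + 1))‖ ^ 2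
      ≤ 2 * fbar + ∑ t ∈ Finset.Icc 1 T,
          β t * (⟪gtil t - gradient φ (x t),
                  (β t)⁻¹ • (x t - proj (x t - β t • gradient φ (x t)))⟫
                + ‖gtil t - gradient φ (x t)‖ ^ 2) := by
  have hmem : ∀ t ∈ Finset.Icc 1 (T + 1), x t ∈ X := by
    intro t ht
    rw [Finset.mem_Icc] at ht
    obtain rfl | hlt := ht.1.eq_or_lt
    · exact hx1
    · obtain ⟨s, rfl⟩ : ∃ s, t = s + 1 := ⟨t - 1, by lia⟩
      rw [hiter s (Finset.mem_Icc.2 (by lia))]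
      exact (hproj _).1
  have hsum := Finset.sum_le_sum fun t (ht : t ∈ Finset.Icc 1 T) =>
    projected_gradient_step_le hXconv hproj hφ hL.le hLip (hβ t ht).1
      (hmem t (Finset.Icc_subset_Icc_right T.le_succ ht)) (gtil t)
  rw [Finset.sum_add_distrib] at hsum
  have htel : ∑ t ∈ Finset.Icc 1 T, (φ (x t) - φ (proj (x t - β t • gtil t)))
      = φ (x 1) - φ (x (T + 1)) := by
    rw [Finset.sum_congr rfl fun t ht => by rw [← hiter t ht], ← Finset.Ico_add_one_right_eq_Icc,
      ← neg_inj, ← Finset.sum_neg_distrib]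
    simpa using Finset.sum_Ico_sub (fun t => φ (x t)) (by lia : 1 ≤ T + 1)
  have hfirst := abs_le.1 (hφbdd _ hx1)
  have hlast := abs_le.1 (hφbdd _ (hmem (T + 1) (Finset.mem_Icc.2 (by lia))))
  rw [Finset.sum_congr rfl fun t ht => by rw [hiter t ht]]
  linarith
end

section
/- Let m ≥ 1, let L > 0, and let g : ℝ^m → ℝ be twice continuously differentiable with ‖∇g(y₁) − ∇g(y₂)‖ ≤ L ‖y₁ − y₂‖ for all y₁, y₂ ∈ ℝ^m, and let 0 < η < 1/L. Then the map F : ℝ^m → ℝ^m defined by F(y) = y − η ∇g(y) is a bijection of ℝ^m onto itself; F is continuously differentiable with derivative I − η ∇²g(y) invertible at every y; and the inverse map F⁻¹ is differentiable at every point (so F is a C¹ diffeomorphism of ℝ^m). -/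
open scoped NNReal

section LipschitzPerturbation

variable {E : Type*} [NormedAddCommGroup E] [NormedSpace ℝ E]
  {f : E → E} {K : ℝ≥0}

theorem LipschitzWith.approximatesLinearOn_id_sub (hf : LipschitzWith K f) :
    ApproximatesLinearOn (fun y => y - f y)
      (ContinuousLinearEquiv.refl ℝ E : E →L[ℝ] E) Set.univ K := by
  intro x _ y _
  have h : x - f x - (y - f y) - (x - y) = -(f x - f y) := by abel
  simpa [h, dist_eq_norm, norm_sub_rev (f x)] using hf.dist_le_mul x y

theorem subsingleton_or_lt_inv_nnnorm_refl_symm (hK : K < 1) :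
    Subsingleton E ∨
      K < ‖((ContinuousLinearEquiv.refl ℝ E).symm : E →L[ℝ] E)‖₊⁻¹ := by
  rcases subsingleton_or_nontrivial E with h | h
  · exact .inl h
  · right
    have : ‖((ContinuousLinearEquiv.refl ℝ E).symm : E →L[ℝ] E)‖₊ = 1 :=
      ContinuousLinearMap.nnnorm_id
    rwa [this, inv_one]

variable [CompleteSpace E]

/-- Subtracting a contraction from the identity of a Banach space gives a bijection. -/
theorem LipschitzWith.bijective_id_sub (hf : LipschitzWith K f) (hK : K < 1) :
    Function.Bijective (fun y => y - f y) :=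
  (hf.approximatesLinearOn_id_sub.toHomeomorph _
    (subsingleton_or_lt_inv_nnnorm_refl_symm hK)).bijective

theorem LipschitzWith.bijective_id_sub_fderiv (hf : LipschitzWith K f) (hK : K < 1) (y : E) :
    Function.Bijective (ContinuousLinearMap.id ℝ E - fderiv ℝ f y) :=
  ((fderiv ℝ f y).lipschitz.weaken (norm_fderiv_le_of_lipschitz ℝ hf)).bijective_id_sub hK

theorem LipschitzWith.differentiableAt_invFun_id_sub (hf : LipschitzWith K f) (hK : K < 1)
    (hd : Differentiable ℝ f) (w : E) :
    DifferentiableAt ℝ (Function.invFun (fun y => y - f y)) w := by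
  have hbij := hf.bijective_id_sub hK
  have hright := Function.rightInverse_invFun hbij.surjective
  have hcont : Continuous (Function.invFun (fun y => y - f y)) := by
    let h := hf.approximatesLinearOn_id_sub.toHomeomorph _
      (subsingleton_or_lt_inv_nnnorm_refl_symm hK)
    convert h.symm.continuous using 1
    funext z
    exact h.injective ((hright z).trans (h.apply_symm_apply z).symm)
  have hF := (hasFDerivAt_id (Function.invFun (fun y => y - f y) w)).sub (hd _).hasFDerivAt
  have hker := hf.bijective_id_sub_fderiv hK (Function.invFun (fun y => y - f y) w)
  let e := ContinuousLinearEquiv.ofBijective _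
    (LinearMap.ker_eq_bot.2 hker.injective) (LinearMap.range_eq_top.2 hker.surjective)
  exact (HasFDerivAt.of_local_left_inverse (f' := e) hcont.continuousAt hF
    (Filter.Eventually.of_forall hright)).differentiableAt

end LipschitzPerturbation


/-- If `g : ℝᵐ → ℝ` is C² with `L`-Lipschitz gradient and `0 < η < 1/L`,
then `F(y) = y - η ∇g(y)` is a bijection of `ℝᵐ`; `F` is continuously differentiable, with
derivative `I - η ∇²g(y)` at each `y`, which is invertible; and the inverse map `F⁻¹` is
differentiable at every point (so `F` is a C¹ diffeomorphism). -/
theorem stmt_17 (m : ℕ) (hm : 1 ≤ m) (L : ℝ) (hL : 0 < L)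
    (g : EuclideanSpace ℝ (Fin m) → ℝ) (hg : ContDiff ℝ 2 g)
    (hLip : ∀ y₁ y₂, ‖gradient g y₁ - gradient g y₂‖ ≤ L * ‖y₁ - y₂‖)
    (η : ℝ) (hη0 : 0 < η) (hη1 : η < 1 / L) :
    Function.Bijective (fun y => y - η • gradient g y) ∧
    ContDiff ℝ 1 (fun y => y - η • gradient g y) ∧
    (∀ y : EuclideanSpace ℝ (Fin m),
      HasFDerivAt (fun y' => y' - η • gradient g y')
        (ContinuousLinearMap.id ℝ (EuclideanSpace ℝ (Fin m))
          - η • fderiv ℝ (fun y' => gradient g y') y) y ∧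
      Function.Bijective
        ⇑(ContinuousLinearMap.id ℝ (EuclideanSpace ℝ (Fin m))
          - η • fderiv ℝ (fun y' => gradient g y') y)) ∧
    (∀ w : EuclideanSpace ℝ (Fin m),
      DifferentiableAt ℝ (Function.invFun (fun y => y - η • gradient g y)) w) := by
  have hgrad : ContDiff ℝ 1 (gradient g) :=
    (InnerProductSpace.toDual ℝ (EuclideanSpace ℝ (Fin m))).symm.contDiff.comp
      (hg.fderiv_right (by norm_num))
  have hdiff : Differentiable ℝ (fun y => η • gradient g y) :=
    (hgrad.differentiable one_ne_zero).const_smul η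
  have hK : (⟨η * L, by positivity⟩ : ℝ≥0) < 1 := by
    rw [lt_div_iff₀ hL] at hη1
    exact hη1
  have hlip : LipschitzWith ⟨η * L, by positivity⟩ (fun y => η • gradient g y) := by
    refine LipschitzWith.of_dist_le_mul fun y₁ y₂ => ?_
    rw [dist_eq_norm, dist_eq_norm, ← smul_sub, norm_smul, Real.norm_of_nonneg hη0.le]
    calc η * ‖gradient g y₁ - gradient g y₂‖ ≤ η * (L * ‖y₁ - y₂‖) := by gcongr; exact hLip _ _
      _ = η * L * ‖y₁ - y₂‖ := by ring
  have hfderiv : ∀ y, fderiv ℝ (fun y' => η • gradient g y') y =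
      η • fderiv ℝ (fun y' => gradient g y') y := fun y =>
    fderiv_fun_const_smul (hgrad.differentiable one_ne_zero y) η
  refine ⟨hlip.bijective_id_sub hK, contDiff_id.sub (hgrad.const_smul η), fun y => ?_, fun w =>
    hlip.differentiableAt_invFun_id_sub hK hdiff w⟩
  rw [← hfderiv]
  exact ⟨(hasFDerivAt_id y).sub (hdiff y).hasFDerivAt, hlip.bijective_id_sub_fderiv hK y⟩
end

section
/- Let g : ℝ × ℝ → ℝ be twice continuously differentiable and let R > 0. Assume that for every x ∈ [0,1]: (i) every y ∈ ℝ with ∂g/∂y(x,y) = 0 satisfies |y| ≤ R, and (ii) ∂²g/∂y²(x,y) ≠ 0 at every such y (all stationary points of g(x,·) are non-degenerate). Then for every x ∈ [0,1] the set C(x) = {y ∈ ℝ : ∂g/∂y(x,y) = 0} is finite, and all the sets C(x) for x ∈ [0,1] have the same cardinality. In particular, it is impossible that g(0,·) has exactly three stationary points while g(1,·) has exactly one, so such a family cannot be Morse in y for every x ∈ [0,1]. -/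
open Set Filter Topology

/-- The derivative of a slice `y ↦ G (x, y)` is the partial derivative of `G`. -/
theorem deriv_slice_eq_fderiv {G : ℝ × ℝ → ℝ} (hG : Differentiable ℝ G) (x y : ℝ) :
    deriv (fun t => G (x, t)) y = fderiv ℝ G (x, y) (0, 1) := by
  have h : HasDerivAt (fun t : ℝ => (x, t)) ((0 : ℝ), (1 : ℝ)) y :=
    (hasDerivAt_const y x).prodMk (hasDerivAt_id y)
  exact ((hG (x, y)).hasFDerivAt.comp_hasDerivAt y h).deriv

/-- The partial derivative in the second variable of a `C²` function is `C¹`. -/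
theorem contDiff_deriv_slice {G : ℝ × ℝ → ℝ} (hG : ContDiff ℝ 2 G) :
    ContDiff ℝ 1 (fun p : ℝ × ℝ => deriv (fun t => G (p.1, t)) p.2) := by
  simp only [deriv_slice_eq_fderiv (hG.differentiable two_ne_zero)]
  exact (hG.fderiv_right (m := 1) (by norm_num)).clm_apply contDiff_const

/-- Near a non-degenerate zero, the zero set of a `C¹` function of two real variables is a graph. -/
theorem exists_implicit_zero {F : ℝ × ℝ → ℝ} (hF : ContDiff ℝ 1 F) {x y : ℝ} (h0 : F (x, y) = 0)
    (h1 : deriv (fun t => F (x, t)) y ≠ 0) :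
    ∃ ψ : ℝ → ℝ, Tendsto ψ (𝓝 x) (𝓝 y) ∧ (∀ᶠ p in 𝓝 (x, y), F p = 0 ↔ ψ p.1 = p.2) ∧
      ∀ᶠ z in 𝓝 x, F (z, ψ z) = 0 := by
  rw [deriv_slice_eq_fderiv (hF.differentiable one_ne_zero)] at h1
  have hd : HasStrictFDerivAt F (fderiv ℝ F (x, y)) (x, y) :=
    hF.contDiffAt.hasStrictFDerivAt one_ne_zero
  have hi : (fderiv ℝ F (x, y) ∘L .inr ℝ ℝ ℝ).IsInvertible := by
    refine ⟨ContinuousLinearEquiv.unitsEquivAut ℝ (Units.mk0 _ h1), ?_⟩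
    ext
    simp
  refine ⟨hd.implicitFunctionOfProdDomain hi, hd.tendsto_implicitFunctionOfProdDomain hi, ?_, ?_⟩
  · simpa only [h0] using hd.eventually_apply_eq_iff_implicitFunctionOfProdDomain hi
  · simpa only [h0] using hd.eventually_apply_implicitFunctionOfProdDomain hi

/-- A bounded zero set consisting of non-degenerate zeros is finite. -/
theorem finite_zeros_of_nondegenerate {f : ℝ → ℝ} (hf : Continuous f) {R : ℝ}
    (hbound : ∀ y, f y = 0 → |y| ≤ R) (hnondeg : ∀ y, f y = 0 → deriv f y ≠ 0) :
    {y | f y = 0}.Finite := by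
  have hcompact : IsCompact {y | f y = 0} :=
    isCompact_Icc.of_isClosed_subset (isClosed_eq hf continuous_const)
      fun y hy => abs_le.mp (hbound y hy)
  refine hcompact.finite (isDiscrete_iff_nhdsNE.mpr fun y hy => ?_)
  have hy' : DifferentiableAt ℝ f y := differentiableAt_of_deriv_ne_zero (hnondeg y hy)
  have hne : ∀ᶠ z in 𝓝[≠] y, f z ≠ 0 := hy'.hasDerivAt.eventually_ne (hnondeg y hy)
  rw [← disjoint_iff]
  exact (disjoint_principal_right).mpr hne

/-- The number of zeros of `F (x, ·)` is locally constant on a set of parameters where the zeros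
are uniformly bounded and non-degenerate. -/
theorem eventually_ncard_zeros_eq {F : ℝ × ℝ → ℝ} (hF : ContDiff ℝ 1 F) {R : ℝ} {s : Set ℝ}
    (hbound : ∀ x ∈ s, ∀ y, F (x, y) = 0 → |y| ≤ R)
    (hnondeg : ∀ x ∈ s, ∀ y, F (x, y) = 0 → deriv (fun t => F (x, t)) y ≠ 0)
    {x₀ : ℝ} (hx₀ : x₀ ∈ s) :
    ∀ᶠ x in 𝓝[s] x₀, {y | F (x, y) = 0}.ncard = {y | F (x₀, y) = 0}.ncard := by
  set C : Set ℝ := {y | F (x₀, y) = 0} with hC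
  have hfin : C.Finite := finite_zeros_of_nondegenerate
    (hF.continuous.comp (by fun_prop : Continuous fun y => (x₀, y))) (hbound x₀ hx₀)
    (hnondeg x₀ hx₀)
  have hex : ∀ y : ℝ, ∃ ψ : ℝ → ℝ, y ∈ C → Tendsto ψ (𝓝 x₀) (𝓝 y) ∧
      (∀ᶠ p in 𝓝 (x₀, y), F p = 0 ↔ ψ p.1 = p.2) ∧ ∀ᶠ z in 𝓝 x₀, F (z, ψ z) = 0 := by
    intro y
    by_cases hy : y ∈ C
    · obtain ⟨ψ, hψ⟩ := exists_implicit_zero hF hy (hnondeg x₀ hx₀ y hy)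
      exact ⟨ψ, fun _ => hψ⟩
    · exact ⟨id, fun h => absurd h hy⟩
  choose ψ hψ using hex
  have hzero : ∀ᶠ x in 𝓝 x₀, ∀ y ∈ C, F (x, ψ y x) = 0 :=
    (eventually_all_finite hfin).mpr fun y hy => (hψ y hy).2.2
  have hinj : ∀ᶠ x in 𝓝 x₀, ∀ y ∈ C, ∀ z ∈ C, y ≠ z → ψ y x ≠ ψ z x := by
    refine (eventually_all_finite hfin).mpr fun y hy => (eventually_all_finite hfin).mpr
      fun z hz => ?_
    by_cases hyz : y = z
    · simp [hyz]
    · filter_upwards [((hψ y hy).1.sub (hψ z hz).1).eventually_ne (sub_ne_zero.mpr hyz)]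
        with x hx _ using sub_ne_zero.mp hx
  have hcover : ∀ᶠ x in 𝓝 x₀, ∀ y ∈ Icc (-R) R, F (x, y) = 0 → ∃ z ∈ C, ψ z x = y := by
    refine isCompact_Icc.eventually_forall_of_forall_eventually fun y _ => ?_
    by_cases hy : y ∈ C
    · filter_upwards [(hψ y hy).2.1] with p hp h0 using ⟨y, hy, hp.mp h0⟩
    · filter_upwards [hF.continuous.continuousAt.eventually_ne hy] with p hp h0 using absurd h0 hp
  filter_upwards [nhdsWithin_le_nhds hzero, nhdsWithin_le_nhds hinj, nhdsWithin_le_nhds hcover,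
    self_mem_nhdsWithin] with x hx_zero hx_inj hx_cover hxs
  have himage : {y | F (x, y) = 0} = (fun y => ψ y x) '' C := by
    refine Subset.antisymm (fun y hy => hx_cover y (abs_le.mp (hbound x hxs y hy)) hy) ?_
    rintro _ ⟨y, hy, rfl⟩
    exact hx_zero y hy
  rw [himage]
  refine InjOn.ncard_image fun y hy z hz hyz => ?_
  by_contra hne
  exact hx_inj y hy z hz hne hyz


/-- Let `g : ℝ × ℝ → ℝ` be C² and `R > 0`. If for every `x ∈ [0,1]` all
stationary points `y` of `g(x,·)` satisfy `|y| ≤ R` and are non-degenerate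
(`∂²g/∂y²(x,y) ≠ 0`), then each set `C(x) = {y : ∂g/∂y(x,y) = 0}` is finite and all the
sets `C(x)`, `x ∈ [0,1]`, have the same cardinality. In particular, `g(0,·)` cannot have
exactly three stationary points while `g(1,·)` has exactly one. -/
theorem stmt_18 (g : ℝ → ℝ → ℝ)
    (hg : ContDiff ℝ 2 (fun p : ℝ × ℝ => g p.1 p.2)) (R : ℝ) (hR : 0 < R)
    (hbound : ∀ x ∈ Set.Icc (0 : ℝ) 1, ∀ y : ℝ, deriv (g x) y = 0 → |y| ≤ R)
    (hnondeg : ∀ x ∈ Set.Icc (0 : ℝ) 1, ∀ y : ℝ, deriv (g x) y = 0 →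
      deriv (deriv (g x)) y ≠ 0) :
    (∀ x ∈ Set.Icc (0 : ℝ) 1, {y : ℝ | deriv (g x) y = 0}.Finite) ∧
    (∀ x₁ ∈ Set.Icc (0 : ℝ) 1, ∀ x₂ ∈ Set.Icc (0 : ℝ) 1,
      {y : ℝ | deriv (g x₁) y = 0}.ncard = {y : ℝ | deriv (g x₂) y = 0}.ncard) ∧
    ¬({y : ℝ | deriv (g 0) y = 0}.ncard = 3 ∧ {y : ℝ | deriv (g 1) y = 0}.ncard = 1) := by
  have hF : ContDiff ℝ 1 (fun p : ℝ × ℝ => deriv (g p.1) p.2) := contDiff_deriv_slice hg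
  have hcard : ∀ x₁ ∈ Set.Icc (0 : ℝ) 1, ∀ x₂ ∈ Set.Icc (0 : ℝ) 1,
      {y : ℝ | deriv (g x₁) y = 0}.ncard = {y : ℝ | deriv (g x₂) y = 0}.ncard := by
    intro x₁ h₁ x₂ h₂
    refine isPreconnected_Icc.constant (f := fun x => {y : ℝ | deriv (g x) y = 0}.ncard)
      (fun x hx => ?_) h₁ h₂
    exact tendsto_nhds_of_eventually_eq (eventually_ncard_zeros_eq hF hbound hnondeg hx)
  refine ⟨fun x hx => ?_, hcard, fun ⟨h₀, h₁⟩ => ?_⟩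
  · exact finite_zeros_of_nondegenerate
      (hF.continuous.comp (by fun_prop : Continuous fun y : ℝ => (x, y))) (hbound x hx)
      (hnondeg x hx)
  · have := hcard 0 (by simp) 1 (by simp)
    omega
end
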